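/- arXiv:1707.02888 — 3 statements merged into one kernel-verified Lean document; each statement's English description precedes it below -/
import Mathlib

section
/- (Gidas–Ni–Nirenberg) Let u ∈ C²(B̄₁(0)) be positive in B₁(0) ⊂ ℝⁿ, vanish on ∂B₁(0), and solve -Δu = f(u) in B₁(0) for a locally Lipschitz f (e.g. f(t) = t^p with p > 1). Then u is radially symmetric: u(x) depends only on |x|, and ∂u/∂r < 0 for 0 < |x| < 1. -/
open MeasureTheory Real

/-- The Euclidean Laplacian `Δu = ∑ ∂²u/∂xᵢ²`. -/
noncomputable def lap {n : ℕ} (u : EuclideanSpace ℝ (Fin n) → ℝ)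
    (x : EuclideanSpace ℝ (Fin n)) : ℝ :=
  ∑ i : Fin n, iteratedFDeriv ℝ 2 u x ![EuclideanSpace.single i 1, EuclideanSpace.single i 1]

namespace MovingPlanes

open Set Filter Metric
open scoped Topology InnerProductSpace Laplacian

variable {E : Type*} [NormedAddCommGroup E] [InnerProductSpace ℝ E]

section SecondDerivatives

/-- The second derivative of a `C²` function in a direction is a one-variable second derivative. -/
theorem iteratedFDeriv_two_diag {g : E → ℝ} {x : E} (hg : ContDiffAt ℝ 2 g x) (v : E) :
    iteratedFDeriv ℝ 2 g x ![v, v] = deriv (deriv fun t : ℝ => g (x + t • v)) 0 := by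
  have hline : ∀ t : ℝ, HasDerivAt (fun t : ℝ => x + t • v) v t := fun t => by
    simpa using ((hasDerivAt_id t).smul_const v).const_add x
  have hcont : Tendsto (fun t : ℝ => x + t • v) (𝓝 0) (𝓝 x) := by
    have := (hline 0).continuousAt.tendsto
    simpa using this
  have hev : (deriv fun t : ℝ => g (x + t • v)) =ᶠ[𝓝 0] fun t => fderiv ℝ g (x + t • v) v := by
    filter_upwards [hcont.eventually (hg.eventually (by simp))] with t ht
    have hgt : HasFDerivAt g (fderiv ℝ g (x + t • v)) (x + t • v) :=
      (ht.differentiableAt (by simp)).hasFDerivAt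
    exact (hgt.comp_hasDerivAt t (hline t)).deriv
  have hd : DifferentiableAt ℝ (fderiv ℝ g) x :=
    (hg.fderiv_right (m := 1) (by norm_num)).differentiableAt (by simp)
  have hd' : HasFDerivAt (fderiv ℝ g) (fderiv ℝ (fderiv ℝ g) x) (x + (0 : ℝ) • v) := by
    rw [zero_smul, add_zero]
    exact hd.hasFDerivAt
  have hder : HasDerivAt (fun t : ℝ => fderiv ℝ g (x + t • v)) (fderiv ℝ (fderiv ℝ g) x v) 0 :=
    hd'.comp_hasDerivAt (0 : ℝ) (hline 0)
  have hder' : HasDerivAt (fun t : ℝ => fderiv ℝ g (x + t • v) v)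
      (fderiv ℝ (fderiv ℝ g) x v v) 0 :=
    ((ContinuousLinearMap.apply ℝ ℝ v).hasFDerivAt.comp_hasDerivAt (0 : ℝ) hder)
  rw [hev.deriv_eq, iteratedFDeriv_two_apply, hder'.deriv]
  rfl

theorem deriv_deriv_nonneg_of_isLocalMin {g : ℝ → ℝ} {t : ℝ} (hg : ContinuousAt g t)
    (hmin : IsLocalMin g t) : 0 ≤ deriv (deriv g) t := by
  by_contra! hneg
  have hmax := isLocalMax_of_deriv_deriv_neg hneg hmin.deriv_eq_zero hg
  have hconst : g =ᶠ[𝓝 t] fun _ => g t := by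
    filter_upwards [hmin, hmax] with s hs hs'
    exact le_antisymm hs' hs
  have : deriv g =ᶠ[𝓝 t] fun _ => 0 := by
    simpa using hconst.deriv
  rw [this.deriv_eq] at hneg
  simp at hneg

variable [FiniteDimensional ℝ E]

theorem laplacian_nonneg_of_isLocalMin {g : E → ℝ} {x : E} (hg : ContDiffAt ℝ 2 g x)
    (hmin : IsLocalMin g x) : 0 ≤ Δ g x := by
  rw [InnerProductSpace.laplacian_eq_iteratedFDeriv_stdOrthonormalBasis]
  refine Finset.sum_nonneg fun i _ => ?_
  rw [iteratedFDeriv_two_diag hg]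
  set v := stdOrthonormalBasis ℝ E i
  have hcont : ContinuousAt (fun t : ℝ => x + t • v) 0 := by fun_prop
  have hx : x + (0 : ℝ) • v = x := by simp
  apply deriv_deriv_nonneg_of_isLocalMin
  · exact ContinuousAt.comp (f := fun t : ℝ => x + t • v) (hx.symm ▸ hg.continuousAt) hcont
  · have := hcont.tendsto
    rw [hx] at this
    filter_upwards [this.eventually hmin] with t ht
    simpa using ht

/-- The Laplacian of the exponential of a function with a quadratic expansion. -/
theorem laplacian_exp_of_quadratic {q : E → ℝ} {x p : E} {β : ℝ} (hq : ContDiff ℝ 2 q)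
    (h : ∀ v, q (x + v) = q x + ⟪p, v⟫_ℝ + β * ‖v‖ ^ 2) :
    Δ (fun y => exp (q y)) x = exp (q x) * (‖p‖ ^ 2 + 2 * β * Module.finrank ℝ E) := by
  have hone : ∀ a b c : ℝ,
      deriv (deriv fun t : ℝ => exp (c + t * a + b * t ^ 2)) 0 = exp c * (a ^ 2 + 2 * b) := by
    intro a b c
    have h1 : ∀ t : ℝ, HasDerivAt (fun t : ℝ => c + t * a + b * t ^ 2) (a + b * (2 * t)) t := by
      intro t
      have h2 := (((hasDerivAt_id t).mul_const a).const_add c).add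
        (((hasDerivAt_id t).pow 2).const_mul b)
      refine h2.congr_deriv ?_
      simp
    have h3 : (deriv fun t : ℝ => exp (c + t * a + b * t ^ 2)) =
        fun t => exp (c + t * a + b * t ^ 2) * (a + b * (2 * t)) :=
      funext fun t => (h1 t).exp.deriv
    rw [h3]
    have h4 : HasDerivAt (fun t : ℝ => a + b * (2 * t)) (b * 2) 0 := by
      simpa using (((hasDerivAt_id (0 : ℝ)).const_mul 2).const_mul b).const_add a
    have h5 := ((h1 0).exp.mul h4).deriv
    refine h5.trans ?_
    simp
    ring
  rw [InnerProductSpace.laplacian_eq_iteratedFDeriv_stdOrthonormalBasis]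
  have hc : ContDiffAt ℝ 2 (fun y => exp (q y)) x := hq.exp.contDiffAt
  have hterm : ∀ i, iteratedFDeriv ℝ 2 (fun y => exp (q y)) x
      ![stdOrthonormalBasis ℝ E i, stdOrthonormalBasis ℝ E i] =
      exp (q x) * (⟪p, stdOrthonormalBasis ℝ E i⟫_ℝ ^ 2 + 2 * β) := by
    intro i
    rw [iteratedFDeriv_two_diag hc, ← hone]
    congr 2
    funext t
    rw [h, norm_smul, inner_smul_right, (stdOrthonormalBasis ℝ E).norm_eq_one, mul_one,
      Real.norm_eq_abs, sq_abs]
  simp only [hterm]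
  rw [← Finset.mul_sum, Finset.sum_add_distrib]
  have hpars : ∑ i, ⟪p, stdOrthonormalBasis ℝ E i⟫_ℝ ^ 2 = ‖p‖ ^ 2 := by
    rw [← (stdOrthonormalBasis ℝ E).sum_sq_inner_left p]
  rw [hpars]
  simp
  ring

end SecondDerivatives

section MaximumPrinciple

variable [FiniteDimensional ℝ E]

/-- A weak maximum principle in the presence of a positive strict supersolution. -/
theorem nonneg_of_strict_supersolution {S : Set E} (hS : IsCompact S) {w φ : E → ℝ}
    (hw : ContinuousOn w S) (hφ : ContinuousOn φ S) (hφpos : ∀ x ∈ S, 0 < φ x)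
    (h : ∀ x ∈ S, w x < 0 → S ∈ 𝓝 x ∧ ContDiffAt ℝ 2 w x ∧ ContDiffAt ℝ 2 φ x ∧
      ∃ c : ℝ, Δ w x ≤ c * w x ∧ Δ φ x < c * φ x) :
    ∀ x ∈ S, 0 ≤ w x := by
  intro z hz
  by_contra! hneg
  obtain ⟨x, hxS, hx⟩ := hS.exists_isMinOn ⟨z, hz⟩ (hw.div hφ fun y hy => (hφpos y hy).ne')
  set m := w x / φ x with hm
  have hmneg : m < 0 := lt_of_le_of_lt (hx hz) (div_neg_of_neg_of_pos hneg (hφpos z hz))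
  have hwx : w x = m * φ x := by rw [hm, div_mul_cancel₀ _ (hφpos x hxS).ne']
  have hwneg : w x < 0 := hwx ▸ mul_neg_of_neg_of_pos hmneg (hφpos x hxS)
  obtain ⟨hnhds, hwC, hφC, c, hc1, hc2⟩ := h x hxS hwneg
  have hmin : IsLocalMin (w - m • φ) x := by
    filter_upwards [hnhds] with y hy
    have : m ≤ w y / φ y := hx hy
    rw [le_div_iff₀ (hφpos y hy)] at this
    simp only [Pi.sub_apply, Pi.smul_apply, smul_eq_mul]
    linarith
  have hlap := laplacian_nonneg_of_isLocalMin (hwC.sub (hφC.const_smul m)) hmin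
  have hsub := hwC.laplacian_sub (hφC.const_smul m)
  have hsmul := InnerProductSpace.laplacian_smul m hφC
  have hlap' : 0 ≤ Δ w x - m * Δ φ x := by
    have h' : Δ (w - m • φ) x = Δ w x - m * Δ φ x := by
      rw [← smul_eq_mul m, ← hsmul]; exact hsub
    rw [← h']; exact hlap
  rw [hwx] at hc1
  nlinarith [mul_pos_of_neg_of_neg hmneg (sub_neg.2 hc2)]

/-- The Hopf barrier estimate on a ball. -/
theorem exists_barrier_le {w : E → ℝ} {y : E} {R L : ℝ} (hR : 0 < R) (hL : 0 < L)
    (hw : ContinuousOn w (closedBall y R)) (hnonneg : ∀ x ∈ closedBall y R, 0 ≤ w x)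
    (hC : ∀ x ∈ ball y R, ContDiffAt ℝ 2 w x) (hΔ : ∀ x ∈ ball y R, Δ w x ≤ L * w x)
    (hy : 0 < w y) :
    ∃ a > 0, ∃ c > 0, ∀ x ∈ closedBall y R,
      c * (exp (-a * ‖x - y‖ ^ 2) - exp (-a * R ^ 2)) ≤ w x := by
  obtain ⟨r, hr0, hrR, hr⟩ : ∃ r, 0 < r ∧ r < R ∧ ∀ x ∈ closedBall y r, w y / 2 ≤ w x := by
    have hcy : ContinuousAt w y := hw.continuousAt (closedBall_mem_nhds y hR)
    have hev : ∀ᶠ x in 𝓝 y, w y / 2 < w x := hcy.eventually (lt_mem_nhds (half_lt_self hy))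
    obtain ⟨ρ, hρ, hball⟩ := Metric.eventually_nhds_iff_ball.1 hev
    refine ⟨min (ρ / 2) (R / 2), by positivity, (min_le_right _ _).trans_lt (by linarith),
      fun x hx => (hball x ?_).le⟩
    rw [mem_closedBall] at hx
    rw [mem_ball]
    have := min_le_left (ρ / 2) (R / 2)
    linarith
  set N : ℝ := (Module.finrank ℝ E : ℝ)
  have hN : 0 ≤ N := Nat.cast_nonneg _
  obtain ⟨a, ha0, ha⟩ : ∃ a > 0, L ≤ 4 * a ^ 2 * r ^ 2 - 2 * a * N := by
    refine ⟨(L + 2 * N + 1) / (4 * r ^ 2) + 1, by positivity, ?_⟩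
    set A := (L + 2 * N + 1) / (4 * r ^ 2) + 1 with hA
    have h1 : L + 2 * N + 1 ≤ A * (4 * r ^ 2) := by
      rw [hA, add_mul, div_mul_cancel₀ _ (by positivity)]
      nlinarith [sq_nonneg r]
    have h2 : 1 ≤ A := by rw [hA]; linarith [show 0 ≤ (L + 2 * N + 1) / (4 * r ^ 2) by positivity]
    nlinarith
  refine ⟨a, ha0, w y / 2, half_pos hy, ?_⟩
  set c := w y / 2 with hc
  have hc0 : 0 < c := half_pos hy
  set k := exp (-a * R ^ 2)
  set h : E → ℝ := fun x => exp (-a * ‖x - y‖ ^ 2) with hh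
  have hqC : ContDiff ℝ 2 fun x : E => -a * ‖x - y‖ ^ 2 :=
    contDiff_const.mul ((contDiff_id.sub contDiff_const).norm_sq ℝ)
  have hhC : ContDiff ℝ 2 h := hqC.exp
  have hhΔ : ∀ x, Δ h x = h x * (4 * a ^ 2 * ‖x - y‖ ^ 2 - 2 * a * N) := by
    intro x
    rw [hh, laplacian_exp_of_quadratic (p := (-2 * a) • (x - y)) (β := -a) hqC, norm_smul,
      Real.norm_eq_abs, mul_pow, sq_abs]
    · ring
    · intro v
      rw [show x + v - y = (x - y) + v by abel, norm_add_sq_real, inner_smul_left]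
      simp
      ring
  set b : E → ℝ := fun x => h x - k with hb
  suffices H : ∀ x ∈ closedBall y R, 0 ≤ (w - c • b) x by
    intro x hx
    have := H x hx
    simp only [Pi.sub_apply, Pi.smul_apply, smul_eq_mul, hb, hh] at this
    linarith
  have hbC : ContDiff ℝ 2 b := hhC.sub contDiff_const
  have hbΔ : ∀ x, Δ b x = Δ h x := by
    intro x
    refine ((hhC.contDiffAt (x := x)).laplacian_sub (contDiffAt_const (c := k))).trans ?_
    simp
  refine nonneg_of_strict_supersolution (isCompact_closedBall y R) (φ := fun _ => 1)
    (hw.sub (hbC.const_smul c).continuous.continuousOn) continuousOn_const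
    (fun _ _ => one_pos) ?_
  intro x hx hneg
  simp only [Pi.sub_apply, Pi.smul_apply, smul_eq_mul, hb] at hneg
  have hk : 0 < k := exp_pos _
  have hxr : r < ‖x - y‖ := by
    by_contra! hle
    have h1 := hr x (by rwa [mem_closedBall, dist_eq_norm])
    have h2 : h x ≤ 1 := exp_le_one_iff.2 (by nlinarith [sq_nonneg ‖x - y‖])
    nlinarith
  have hxR : ‖x - y‖ < R := by
    rw [mem_closedBall, dist_eq_norm] at hx
    refine lt_of_le_of_ne hx fun heq => ?_
    have h1 := hnonneg x (by rw [mem_closedBall, dist_eq_norm, heq])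
    have h2 : h x = k := by simp only [hh, heq]; rfl
    rw [h2] at hneg
    linarith
  have hxb : x ∈ ball y R := by rwa [mem_ball, dist_eq_norm]
  have hwC := hC x hxb
  refine ⟨mem_of_superset (isOpen_ball.mem_nhds hxb) ball_subset_closedBall,
    hwC.sub (hbC.const_smul c).contDiffAt, contDiffAt_const, L, ?_, ?_⟩
  · have h1 : Δ (w - c • b) x = Δ w x - c * Δ h x := by
      refine (hwC.laplacian_sub (hbC.const_smul c).contDiffAt).trans ?_
      rw [← hbΔ]
      congr 1
      exact InnerProductSpace.laplacian_smul c hbC.contDiffAt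
    have h2 : L * (h x - k) ≤ Δ h x := by
      rw [hhΔ]
      have hpos : 0 < h x := exp_pos _
      have h3 : L ≤ 4 * a ^ 2 * ‖x - y‖ ^ 2 - 2 * a * N := by
        have : r ^ 2 ≤ ‖x - y‖ ^ 2 := by gcongr
        nlinarith [mul_le_mul_of_nonneg_left this (by positivity : (0 : ℝ) ≤ 4 * a ^ 2)]
      nlinarith [mul_le_mul_of_nonneg_left h3 hpos.le, mul_pos hL hk]
    rw [h1]
    simp only [Pi.sub_apply, Pi.smul_apply, smul_eq_mul, hb]
    nlinarith [hΔ x hxb, mul_le_mul_of_nonneg_left h2 hc0.le]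
  · simpa using hL

theorem pos_on_ball {w : E → ℝ} {y : E} {R L : ℝ} (hL : 0 < L)
    (hw : ContinuousOn w (closedBall y R)) (hnonneg : ∀ x ∈ closedBall y R, 0 ≤ w x)
    (hC : ∀ x ∈ ball y R, ContDiffAt ℝ 2 w x) (hΔ : ∀ x ∈ ball y R, Δ w x ≤ L * w x)
    (hy : 0 < w y) : ∀ x ∈ ball y R, 0 < w x := by
  intro x hx
  have hR : 0 < R := pos_of_mem_ball hx
  obtain ⟨a, ha, c, hc, h⟩ := exists_barrier_le hR hL hw hnonneg hC hΔ hy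
  refine lt_of_lt_of_le (mul_pos hc (sub_pos.2 (exp_lt_exp.2 ?_))) (h x (ball_subset_closedBall hx))
  rw [mem_ball, dist_eq_norm] at hx
  have : ‖x - y‖ ^ 2 < R ^ 2 := by gcongr
  nlinarith

/-- The strong maximum principle. -/
theorem pos_of_isPreconnected {w : E → ℝ} {U : Set E} {L : ℝ} (hU : IsOpen U)
    (hconn : IsPreconnected U) (hL : 0 < L) (hnonneg : ∀ x ∈ U, 0 ≤ w x)
    (hC : ∀ x ∈ U, ContDiffAt ℝ 2 w x) (hΔ : ∀ x ∈ U, Δ w x ≤ L * w x)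
    (hex : ∃ y ∈ U, 0 < w y) : ∀ x ∈ U, 0 < w x := by
  have hw : ContinuousOn w U := fun x hx => (hC x hx).continuousAt.continuousWithinAt
  have hopen : IsOpen (U ∩ w ⁻¹' Ioi 0) := hw.isOpen_inter_preimage hU isOpen_Ioi
  obtain ⟨y₀, hy₀, hwy₀⟩ := hex
  suffices H : U ⊆ U ∩ w ⁻¹' Ioi 0 from fun x hx => (H hx).2
  refine hconn.subset_of_closure_inter_subset hopen ⟨y₀, hy₀, hy₀, hwy₀⟩ ?_
  rintro z ⟨hzcl, hzU⟩
  obtain ⟨ρ, hρ, hball⟩ := Metric.isOpen_iff.1 hU z hzU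
  obtain ⟨y, ⟨-, hwy⟩, hdist⟩ := Metric.mem_closure_iff.1 hzcl (ρ / 3) (by positivity)
  have hsub : closedBall y (ρ / 2) ⊆ U := fun x hx => hball <| by
    rw [mem_closedBall] at hx
    rw [mem_ball]
    have := dist_triangle x y z
    rw [dist_comm z y] at hdist
    linarith
  have hsub' := ball_subset_closedBall.trans hsub
  refine ⟨hzU, pos_on_ball hL (hw.mono hsub) (fun x hx => hnonneg x (hsub hx))
    (fun x hx => hC x (hsub' hx)) (fun x hx => hΔ x (hsub' hx)) hwy z ?_⟩
  rw [mem_ball]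
  linarith

end MaximumPrinciple

section Isometries

variable [FiniteDimensional ℝ E]

theorem laplacian_comp_linearIsometryEquiv (g : E → ℝ) (T : E ≃ₗᵢ[ℝ] E) (x : E) :
    Δ (g ∘ T) x = Δ g (T x) := by
  rw [InnerProductSpace.laplacian_eq_iteratedFDeriv_orthonormalBasis _
      (stdOrthonormalBasis ℝ E),
    InnerProductSpace.laplacian_eq_iteratedFDeriv_orthonormalBasis _
      ((stdOrthonormalBasis ℝ E).map T)]
  refine Finset.sum_congr rfl fun i _ => ?_
  have h := T.toContinuousLinearEquiv.iteratedFDerivWithin_comp_right g uniqueDiffOn_univ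
    (mem_univ (T x)) 2
  simp only [preimage_univ, iteratedFDerivWithin_univ] at h
  have h' : iteratedFDeriv ℝ 2 (g ∘ T) x = _ := h
  rw [h', ContinuousMultilinearMap.compContinuousLinearMap_apply]
  congr 1
  funext j
  fin_cases j <;> rfl

theorem laplacian_comp_add_right (g : E → ℝ) (a x : E) :
    Δ (fun z => g (z + a)) x = Δ g (x + a) := by
  simp only [InnerProductSpace.laplacian_eq_iteratedFDeriv_stdOrthonormalBasis,
    iteratedFDeriv_comp_add_right]

end Isometries

section PlaneReflection

/-- The reflection across the hyperplane `{x | ⟪e, x⟫ = l}`, for a unit vector `e`. -/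
def planeReflection (e : E) (l : ℝ) (x : E) : E := x - (2 * (⟪e, x⟫_ℝ - l)) • e

theorem planeReflection_eq {e : E} (he : ‖e‖ = 1) (l : ℝ) (x : E) :
    planeReflection e l x = (ℝ ∙ e)ᗮ.reflection x + (2 * l) • e := by
  rw [Submodule.reflection_orthogonal_apply, Submodule.reflection_singleton_apply, he,
    planeReflection]
  simp only [RCLike.ofReal_real_eq_id, id_eq, one_pow, div_one, two_smul, mul_sub, sub_smul,
    two_mul, add_smul]
  abel

theorem continuous_planeReflection (e : E) :
    Continuous fun z : ℝ × E => planeReflection e z.1 z.2 := by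
  unfold planeReflection
  fun_prop

theorem contDiff_planeReflection (e : E) (l : ℝ) : ContDiff ℝ 2 (planeReflection e l) :=
  contDiff_id.sub ((contDiff_const.mul
    ((contDiff_const.inner ℝ contDiff_id).sub contDiff_const)).smul contDiff_const)

theorem norm_planeReflection_sq {e : E} (he : ‖e‖ = 1) (l : ℝ) (x : E) :
    ‖planeReflection e l x‖ ^ 2 = ‖x‖ ^ 2 - 4 * l * (⟪e, x⟫_ℝ - l) := by
  rw [planeReflection, norm_sub_sq_real, norm_smul, inner_smul_right, he, mul_one,
    Real.norm_eq_abs, sq_abs, real_inner_comm]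
  ring

theorem planeReflection_of_inner_eq {e : E} {l : ℝ} {x : E} (hx : ⟪e, x⟫_ℝ = l) :
    planeReflection e l x = x := by
  simp [planeReflection, hx]

theorem laplacian_comp_planeReflection [FiniteDimensional ℝ E] {e : E} (he : ‖e‖ = 1) (l : ℝ)
    (g : E → ℝ) (x : E) :
    Δ (g ∘ planeReflection e l) x = Δ g (planeReflection e l x) := by
  have h : g ∘ planeReflection e l =
      (fun z => g (z + (2 * l) • e)) ∘ (ℝ ∙ e)ᗮ.reflection :=
    funext fun z => by simp only [Function.comp_apply, planeReflection_eq he]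
  rw [h, laplacian_comp_linearIsometryEquiv, laplacian_comp_add_right, planeReflection_eq he]

/-- The part of the unit ball lying beyond the hyperplane `{x | ⟪e, x⟫ = l}`. -/
def cap (e : E) (l : ℝ) : Set E := {x | l < ⟪e, x⟫_ℝ ∧ ‖x‖ < 1}

theorem isOpen_cap (e : E) (l : ℝ) : IsOpen (cap e l) := by
  have h1 : IsOpen {x : E | l < ⟪e, x⟫_ℝ} := isOpen_lt (by fun_prop) (by fun_prop)
  have h2 : IsOpen {x : E | ‖x‖ < 1} := isOpen_lt (by fun_prop) (by fun_prop)
  exact h1.inter h2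

theorem convex_cap (e : E) (l : ℝ) : Convex ℝ (cap e l) := by
  have h1 : Convex ℝ {x : E | l < ⟪e, x⟫_ℝ} :=
    convex_halfSpace_gt (innerₗ E e).isLinear l
  have h2 : Convex ℝ {x : E | ‖x‖ < 1} := by
    have := convex_ball (0 : E) 1
    simpa only [ball_zero_eq] using this
  exact h1.inter h2

theorem inner_le_norm_of_unit {e : E} (he : ‖e‖ = 1) (x : E) : ⟪e, x⟫_ℝ ≤ ‖x‖ := by
  simpa [he] using real_inner_le_norm e x

theorem lt_one_of_mem_cap {e : E} (he : ‖e‖ = 1) {l : ℝ} {x : E} (hx : x ∈ cap e l) : l < 1 :=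
  hx.1.trans_le ((inner_le_norm_of_unit he x).trans hx.2.le)

theorem norm_planeReflection_lt_one {e : E} (he : ‖e‖ = 1) {l : ℝ} (hl : 0 < l) {x : E}
    (hx : x ∈ cap e l) : ‖planeReflection e l x‖ < 1 := by
  have h := norm_planeReflection_sq he l x
  have h1 : 0 < l * (⟪e, x⟫_ℝ - l) := mul_pos hl (sub_pos.2 hx.1)
  have h2 : ‖x‖ ^ 2 < 1 := by nlinarith [hx.2, norm_nonneg x]
  nlinarith [norm_nonneg (planeReflection e l x)]

end PlaneReflection

section MovingPlane

/-- A continuous function, positive and `C²` in the unit ball and zero outside, whose Laplacian is a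
Lipschitz function of its value. -/
structure IsBallSolution [FiniteDimensional ℝ E] (v : E → ℝ) (L : ℝ) : Prop where
  continuous : Continuous v
  eq_zero : ∀ x, 1 ≤ ‖x‖ → v x = 0
  pos : ∀ x, ‖x‖ < 1 → 0 < v x
  contDiffAt : ∀ x, ‖x‖ < 1 → ContDiffAt ℝ 2 v x
  const_pos : 0 < L
  abs_laplacian_sub_le : ∀ x y, ‖x‖ < 1 → ‖y‖ < 1 → |Δ v x - Δ v y| ≤ L * |v x - v y|

/-- The difference between the reflected function and the function itself. -/
def reflectionDiff (v : E → ℝ) (e : E) (l : ℝ) (x : E) : ℝ := v (planeReflection e l x) - v x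

variable [FiniteDimensional ℝ E] {v : E → ℝ} {L : ℝ} {e : E} {l : ℝ}

namespace IsBallSolution

theorem continuous_reflectionDiff (hv : IsBallSolution v L) (e : E) :
    Continuous fun z : ℝ × E => reflectionDiff v e z.1 z.2 :=
  (hv.continuous.comp (continuous_planeReflection e)).sub (hv.continuous.comp continuous_snd)

theorem nonneg (hv : IsBallSolution v L) (x : E) : 0 ≤ v x := by
  rcases lt_or_ge ‖x‖ 1 with h | h
  · exact (hv.pos x h).le
  · exact (hv.eq_zero x h).ge

theorem contDiffAt_reflectionDiff (hv : IsBallSolution v L) (he : ‖e‖ = 1) (hl : 0 < l) {x : E}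
    (hx : x ∈ cap e l) : ContDiffAt ℝ 2 (reflectionDiff v e l) x :=
  ((hv.contDiffAt _ (norm_planeReflection_lt_one he hl hx)).comp x
    (contDiff_planeReflection e l).contDiffAt).sub (hv.contDiffAt x hx.2)

theorem abs_laplacian_reflectionDiff_le (hv : IsBallSolution v L) (he : ‖e‖ = 1) (hl : 0 < l)
    {x : E} (hx : x ∈ cap e l) :
    |Δ (reflectionDiff v e l) x| ≤ L * |reflectionDiff v e l x| := by
  have hr := norm_planeReflection_lt_one he hl hx
  have h : Δ (reflectionDiff v e l) x = Δ v (planeReflection e l x) - Δ v x := by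
    rw [← laplacian_comp_planeReflection he l v x]
    exact ((hv.contDiffAt _ hr).comp x (contDiff_planeReflection e l).contDiffAt).laplacian_sub
      (hv.contDiffAt x hx.2)
  rw [h]
  exact hv.abs_laplacian_sub_le _ _ hr hx.2

/-- The maximum principle in the part of a cap close to its boundary. -/
theorem exists_narrow (hv : IsBallSolution v L) (he : ‖e‖ = 1) :
    ∃ k : ℝ, 0 < k ∧ ∀ l, 0 < l →
      (∀ x ∈ cap e l, l + 1 / k ≤ ⟪e, x⟫_ℝ → ‖x‖ ^ 2 ≤ 1 - 1 / k → 0 ≤ reflectionDiff v e l x) →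
      ∀ x ∈ cap e l, 0 ≤ reflectionDiff v e l x := by
  have hL := hv.const_pos
  set k : ℝ := 9 * L + 2 with hk
  have hk2 : 2 ≤ k := by linarith
  have hk0 : 0 < k := by linarith
  refine ⟨k, hk0, fun l hl hK => ?_⟩
  set S : Set E := {x | l ≤ ⟪e, x⟫_ℝ} ∩ closedBall 0 1 with hS
  have hScompact : IsCompact S :=
    (isCompact_closedBall 0 1).inter_left (isClosed_le (by fun_prop) (by fun_prop))
  set q₁ : E → ℝ := fun x => -k * (⟪e, x⟫_ℝ - l)
  set q₂ : E → ℝ := fun x => -k * (1 - ‖x‖ ^ 2)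
  have hq₁ : ContDiff ℝ 2 q₁ :=
    contDiff_const.mul ((contDiff_const.inner ℝ contDiff_id).sub contDiff_const)
  have hq₂ : ContDiff ℝ 2 q₂ :=
    contDiff_const.mul (contDiff_const.sub (contDiff_id.norm_sq ℝ))
  have hΔ₁ : ∀ x, Δ (fun y => exp (q₁ y)) x = exp (q₁ x) * k ^ 2 := fun x => by
    rw [laplacian_exp_of_quadratic (p := -k • e) (β := 0) hq₁, norm_smul, he]
    · simp
    · intro y
      simp only [q₁, inner_add_right, inner_smul_left]
      simp
      ring
  have hΔ₂ : ∀ x, Δ (fun y => exp (q₂ y)) x =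
      exp (q₂ x) * (4 * k ^ 2 * ‖x‖ ^ 2 + 2 * k * Module.finrank ℝ E) := fun x => by
    rw [laplacian_exp_of_quadratic (p := (2 * k) • x) (β := k) hq₂, norm_smul, Real.norm_eq_abs,
      mul_pow, sq_abs]
    · ring
    · intro y
      simp only [q₂, norm_add_sq_real, inner_smul_left]
      simp
      ring
  set φ : E → ℝ := fun x => 3 - exp (q₁ x) - exp (q₂ x)
  have hφC : ContDiff ℝ 2 φ := (contDiff_const.sub hq₁.exp).sub hq₂.exp
  have hφΔ : ∀ x, Δ φ x = -Δ (fun y => exp (q₁ y)) x - Δ (fun y => exp (q₂ y)) x := fun x => by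
    have h1 : Δ φ x = Δ (fun y => 3 - exp (q₁ y)) x - Δ (fun y => exp (q₂ y)) x :=
      (contDiff_const.sub hq₁.exp).contDiffAt.laplacian_sub hq₂.exp.contDiffAt
    have h2 : Δ (fun y => 3 - exp (q₁ y)) x =
        Δ (fun _ : E => (3 : ℝ)) x - Δ (fun y => exp (q₁ y)) x :=
      contDiffAt_const.laplacian_sub hq₁.exp.contDiffAt
    rw [h1, h2]
    simp
  have hφpos : ∀ x ∈ S, 0 < φ x := by
    rintro x ⟨hx1, hx2⟩
    rw [mem_closedBall_zero_iff] at hx2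
    have h1 : exp (q₁ x) ≤ 1 := exp_le_one_iff.2 (by
      have : l ≤ ⟪e, x⟫_ℝ := hx1
      simp only [q₁]; nlinarith)
    have h2 : exp (q₂ x) ≤ 1 := exp_le_one_iff.2 (by
      have : ‖x‖ ^ 2 ≤ 1 := by nlinarith [norm_nonneg x]
      simp only [q₂]; nlinarith)
    simp only [φ]
    linarith
  have hwcont : Continuous (reflectionDiff v e l) :=
    (hv.continuous_reflectionDiff e).comp (Continuous.prodMk_right l)
  suffices H : ∀ x ∈ S, 0 ≤ reflectionDiff v e l x from fun x hx =>
    H x ⟨hx.1.le, mem_closedBall_zero_iff.2 hx.2.le⟩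
  refine nonneg_of_strict_supersolution hScompact hwcont.continuousOn hφC.continuous.continuousOn
    hφpos ?_
  rintro x ⟨hx1, hx2⟩ hneg
  rw [mem_closedBall_zero_iff] at hx2
  have hx : x ∈ cap e l := by
    refine ⟨lt_of_le_of_ne hx1 fun h => ?_, lt_of_le_of_ne hx2 fun h => ?_⟩
    · simp [reflectionDiff, planeReflection_of_inner_eq h.symm] at hneg
    · rw [reflectionDiff, hv.eq_zero x h.ge] at hneg
      linarith [hv.nonneg (planeReflection e l x)]
  refine ⟨mem_of_superset ((isOpen_cap e l).mem_nhds hx) fun y hy =>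
    ⟨hy.1.le, mem_closedBall_zero_iff.2 hy.2.le⟩, hv.contDiffAt_reflectionDiff he hl hx,
    hφC.contDiffAt, -L, ?_, ?_⟩
  · have := (le_abs_self _).trans (hv.abs_laplacian_reflectionDiff_le he hl hx)
    rw [abs_of_neg hneg] at this
    linarith
  · have hexp : (1 : ℝ) / 3 ≤ exp (-1) := by
      rw [exp_neg, ← one_div]
      exact one_div_le_one_div_of_le (exp_pos 1) (exp_one_lt_three.le)
    have hkey : k ^ 2 * exp (-1) ≤
        exp (q₁ x) * k ^ 2 + exp (q₂ x) * (4 * k ^ 2 * ‖x‖ ^ 2 + 2 * k * Module.finrank ℝ E) := by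
      have hE1 := exp_pos (q₁ x)
      have hE2 := exp_pos (q₂ x)
      have hkk : k * (1 / k) = 1 := mul_one_div_cancel hk0.ne'
      rcases lt_or_ge ⟪e, x⟫_ℝ (l + 1 / k) with h | h
      · have h1 : exp (-1) ≤ exp (q₁ x) := exp_le_exp.2 (by
          simp only [q₁]
          nlinarith)
        have h2 : 0 ≤ exp (q₂ x) * (4 * k ^ 2 * ‖x‖ ^ 2 + 2 * k * Module.finrank ℝ E) := by
          positivity
        nlinarith [mul_le_mul_of_nonneg_left h1 (sq_nonneg k)]
      · have h' : 1 - 1 / k < ‖x‖ ^ 2 := by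
          by_contra! hle
          exact hneg.not_ge (hK x hx h hle)
        have h1 : exp (-1) ≤ exp (q₂ x) := exp_le_exp.2 (by
          simp only [q₂]
          nlinarith)
        have h2 : 1 / k ≤ 1 / 2 := one_div_le_one_div_of_le two_pos hk2
        have h3 : k ^ 2 ≤ 4 * k ^ 2 * ‖x‖ ^ 2 + 2 * k * Module.finrank ℝ E := by
          have : 0 ≤ 2 * k * (Module.finrank ℝ E : ℝ) := by positivity
          nlinarith [sq_nonneg k]
        calc k ^ 2 * exp (-1) = exp (-1) * k ^ 2 := mul_comm _ _
          _ ≤ exp (q₂ x) * (4 * k ^ 2 * ‖x‖ ^ 2 + 2 * k * Module.finrank ℝ E) := by gcongr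
          _ ≤ _ := le_add_of_nonneg_left (by positivity)
    have hφ3 : φ x ≤ 3 := by
      simp only [φ]
      linarith [exp_pos (q₁ x), exp_pos (q₂ x)]
    rw [hφΔ, hΔ₁, hΔ₂]
    nlinarith [mul_le_mul_of_nonneg_left hexp (sq_nonneg k)]

theorem reflectionDiff_pos (hv : IsBallSolution v L) (he : ‖e‖ = 1) (hl : 0 < l)
    (hnonneg : ∀ x ∈ cap e l, 0 ≤ reflectionDiff v e l x) :
    ∀ x ∈ cap e l, 0 < reflectionDiff v e l x := by
  intro x hx
  have hl1 := lt_one_of_mem_cap he hx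
  refine pos_of_isPreconnected (isOpen_cap e l) (convex_cap e l).isPreconnected hv.const_pos hnonneg
    (fun y hy => hv.contDiffAt_reflectionDiff he hl hy) (fun y hy => ?_) ?_ x hx
  · have := (le_abs_self _).trans (hv.abs_laplacian_reflectionDiff_le he hl hy)
    rwa [abs_of_nonneg (hnonneg y hy)] at this
  · have hee : ⟪e, e⟫_ℝ = 1 := by rw [real_inner_self_eq_norm_sq, he, one_pow]
    have hcont : Continuous fun t : ℝ => reflectionDiff v e l (t • e) :=
      (hv.continuous_reflectionDiff e).comp (by fun_prop : Continuous fun t : ℝ => (l, t • e))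
    have hpos : 0 < reflectionDiff v e l ((1 : ℝ) • e) := by
      have hr : ‖planeReflection e l e‖ < 1 := by
        have h := norm_planeReflection_sq he l e
        rw [he, hee] at h
        nlinarith [norm_nonneg (planeReflection e l e), mul_pos hl (sub_pos.2 hl1)]
      rw [one_smul, reflectionDiff, hv.eq_zero e he.ge, sub_zero]
      exact hv.pos _ hr
    have hev : ∀ᶠ t in 𝓝[<] (1 : ℝ), 0 < reflectionDiff v e l (t • e) :=
      nhdsWithin_le_nhds (hcont.continuousAt.eventually (lt_mem_nhds hpos))
    obtain ⟨t, ht, htI⟩ := (hev.and (Ioo_mem_nhdsLT hl1)).exists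
    refine ⟨t • e, ⟨?_, ?_⟩, ht⟩
    · rw [inner_smul_right, hee, mul_one]
      exact htI.1
    · rw [norm_smul, he, mul_one, Real.norm_eq_abs, abs_of_pos (hl.trans htI.1)]
      exact htI.2

/-- The plane can be moved all the way to the centre of the ball. -/
theorem reflectionDiff_nonneg (hv : IsBallSolution v L) (he : ‖e‖ = 1) (hl : 0 < l) :
    ∀ x ∈ cap e l, 0 ≤ reflectionDiff v e l x := by
  rcases le_or_gt 1 l with h1 | h1
  · exact fun x hx => absurd (lt_one_of_mem_cap he hx) h1.not_gt
  obtain ⟨k, hk, hnarrow⟩ := hv.exists_narrow he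
  set s : Set ℝ := {t | ∀ x ∈ cap e (1 - t), 0 ≤ reflectionDiff v e (1 - t) x} with hs
  have hclosed : IsClosed s := by
    have : s = ⋂ x : {x : E // ‖x‖ < 1},
        ({t | ⟪e, (x : E)⟫_ℝ ≤ 1 - t} ∪ {t | 0 ≤ reflectionDiff v e (1 - t) x}) := by
      ext t
      simp only [hs, mem_ofPred_eq, mem_iInter, mem_union, Subtype.forall, cap, and_imp]
      refine forall_congr' fun x => ?_
      rw [← not_lt (a := 1 - t)]
      tauto
    rw [this]
    refine isClosed_iInter fun x => (isClosed_le (by fun_prop) (by fun_prop)).union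
      (isClosed_le continuous_const ?_)
    exact (hv.continuous_reflectionDiff e).comp
      (by fun_prop : Continuous fun t : ℝ => (1 - t, (x : E)))
  have hstart : (0 : ℝ) ∈ s := fun x hx => by
    have := lt_one_of_mem_cap he hx
    simp at this
  have hsub : Icc 0 (1 - l) ⊆ s := by
    refine IsClosed.Icc_subset_of_forall_mem_nhdsWithin (hclosed.inter isClosed_Icc) hstart ?_
    rintro t ⟨hts, ht0, htl⟩
    set m := 1 - t with hm
    have hm0 : 0 < m := by linarith
    have hpos := hv.reflectionDiff_pos he hm0 hts
    set K : Set E := {x | m + 1 / (2 * k) ≤ ⟪e, x⟫_ℝ} ∩ {x | ‖x‖ ^ 2 ≤ 1 - 1 / k} ∩ closedBall 0 1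
    have hKcompact : IsCompact K := (isCompact_closedBall 0 1).inter_left
      ((isClosed_le (by fun_prop) (by fun_prop)).inter (isClosed_le (by fun_prop) (by fun_prop)))
    have hk1 : 0 < 1 / k := by positivity
    have hk2 : 1 / (2 * k) = 1 / k / 2 := by field_simp
    have hKev : ∀ᶠ μ in 𝓝 m, ∀ x ∈ K, 0 < reflectionDiff v e μ x := by
      refine hKcompact.eventually_forall_of_forall_eventually fun x hx => ?_
      have hxcap : x ∈ cap e m := by
        obtain ⟨⟨hx1, hx2⟩, -⟩ := hx
        simp only [mem_ofPred_eq] at hx1 hx2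
        exact ⟨by linarith, by nlinarith [norm_nonneg x]⟩
      exact (hv.continuous_reflectionDiff e).continuousAt.eventually (lt_mem_nhds (hpos x hxcap))
    have htend : Tendsto (fun r : ℝ => 1 - r) (𝓝 t) (𝓝 m) :=
      (continuous_const.sub continuous_id).tendsto t
    refine nhdsWithin_le_nhds ?_
    filter_upwards [htend.eventually hKev, htend.eventually (lt_mem_nhds hm0),
      htend.eventually (lt_mem_nhds (show m - 1 / k / 2 < m by linarith))] with r hr hr0 hrk
    refine hnarrow (1 - r) hr0 fun x hx hx1 hx2 => (hr x ⟨⟨?_, hx2⟩, ?_⟩).le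
    · simp only [mem_ofPred_eq]
      linarith
    · exact mem_closedBall_zero_iff.2 hx.2.le
  have := hsub ⟨by linarith, le_rfl⟩
  simpa [hs] using this

theorem fderiv_neg (hv : IsBallSolution v L) (he : ‖e‖ = 1) {x : E} (hx : ‖x‖ < 1)
    (hpos : 0 < ⟪e, x⟫_ℝ) : fderiv ℝ v x e < 0 := by
  set l := ⟪e, x⟫_ℝ with hl
  have hee : ⟪e, e⟫_ℝ = 1 := by rw [real_inner_self_eq_norm_sq, he, one_pow]
  have hnonneg := hv.reflectionDiff_nonneg he hpos
  have hwpos := hv.reflectionDiff_pos he hpos hnonneg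
  set R := (1 - ‖x‖) / 4 with hR
  have hR0 : 0 < R := by linarith
  set y := x + R • e with hy
  have hnorm : ∀ z ∈ closedBall y R, ‖z‖ < 1 := by
    intro z hz
    rw [mem_closedBall, dist_eq_norm] at hz
    have h1 : ‖y‖ ≤ ‖x‖ + R := by
      refine (norm_add_le _ _).trans ?_
      rw [norm_smul, he, mul_one, Real.norm_eq_abs, abs_of_pos hR0]
    have h2 : ‖z‖ ≤ ‖z - y‖ + ‖y‖ := by simpa using norm_add_le (z - y) y
    linarith
  have hinner : ∀ z, l + R - ‖z - y‖ ≤ ⟪e, z⟫_ℝ := by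
    intro z
    have h1 := inner_le_norm_of_unit he (y - z)
    rw [norm_sub_rev, inner_sub_right, hy, inner_add_right, inner_smul_right, hee, ← hl] at h1
    linarith
  have hcap : ball y R ⊆ cap e l := fun z hz => by
    refine ⟨?_, hnorm z (ball_subset_closedBall hz)⟩
    rw [mem_ball, dist_eq_norm] at hz
    linarith [hinner z]
  have hyR : y ∈ ball y R := mem_ball_self hR0
  have hwcont : Continuous (reflectionDiff v e l) :=
    (hv.continuous_reflectionDiff e).comp (Continuous.prodMk_right l)
  obtain ⟨a, ha, c, hc, hbar⟩ := exists_barrier_le (w := reflectionDiff v e l) hR0 hv.const_pos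
    hwcont.continuousOn
    (fun z hz => by
      have h1 := hinner z
      rw [mem_closedBall, dist_eq_norm] at hz
      rcases (show l ≤ ⟪e, z⟫_ℝ by linarith).eq_or_lt with h | h
      · simp [reflectionDiff, planeReflection_of_inner_eq h.symm]
      · exact hnonneg z ⟨h, hnorm z (by rwa [mem_closedBall, dist_eq_norm])⟩)
    (fun z hz => hv.contDiffAt_reflectionDiff he hpos (hcap hz))
    (fun z hz => by
      have := (le_abs_self _).trans (hv.abs_laplacian_reflectionDiff_le he hpos (hcap hz))
      rwa [abs_of_nonneg (hnonneg z (hcap hz))] at this)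
    (hwpos y (hcap hyR))
  set g : ℝ → ℝ := fun t => v (x + (-t) • e) - v (x + t • e) -
    c * (exp (-a * (t - R) ^ 2) - exp (-a * R ^ 2)) with hg
  have hg0 : g 0 = 0 := by simp [hg]
  have hgnonneg : ∀ t ∈ Ioo 0 R, 0 ≤ g t := by
    intro t ht
    have hsub : x + t • e - y = (t - R) • e := by rw [hy, sub_smul]; abel
    have hn : ‖x + t • e - y‖ ^ 2 = (t - R) ^ 2 := by
      rw [hsub, norm_smul, he, mul_one, Real.norm_eq_abs, sq_abs]
    have hmem : x + t • e ∈ closedBall y R := by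
      rw [mem_closedBall, dist_eq_norm]
      nlinarith [norm_nonneg (x + t • e - y), ht.1, ht.2]
    have h := hbar _ hmem
    have hrefl : planeReflection e l (x + t • e) = x + (-t) • e := by
      rw [planeReflection, inner_add_right, inner_smul_right, hee, ← hl, neg_smul]
      module
    rw [hn, reflectionDiff, hrefl] at h
    simp only [hg]
    linarith
  have hdv : HasFDerivAt v (fderiv ℝ v x) x :=
    ((hv.contDiffAt x hx).differentiableAt (by simp)).hasFDerivAt
  have hline : ∀ σ : ℝ, HasDerivAt (fun t : ℝ => v (x + (σ * t) • e)) (σ * fderiv ℝ v x e) 0 := by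
    intro σ
    have h1 : HasDerivAt (fun t : ℝ => x + (σ * t) • e) (σ • e) 0 := by
      simpa using (((hasDerivAt_id (0 : ℝ)).const_mul σ).smul_const e).const_add x
    have h2 : HasFDerivAt v (fderiv ℝ v x) (x + (σ * 0) • e) := by simpa using hdv
    have h3 := h2.comp_hasDerivAt (0 : ℝ) h1
    rwa [map_smul, smul_eq_mul] at h3
  have hdexp : HasDerivAt (fun t : ℝ => exp (-a * (t - R) ^ 2))
      (exp (-a * R ^ 2) * (2 * a * R)) 0 := by
    have h1 : HasDerivAt (fun t : ℝ => -a * (t - R) ^ 2) (2 * a * R) 0 := by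
      refine ((((hasDerivAt_id (0 : ℝ)).sub_const R).pow 2).const_mul (-a)).congr_deriv ?_
      simp
      ring
    simpa using h1.exp
  have hdg : HasDerivAt g (-1 * fderiv ℝ v x e - 1 * fderiv ℝ v x e -
      c * (exp (-a * R ^ 2) * (2 * a * R))) 0 := by
    have h := ((hline (-1)).sub (hline 1)).sub ((hdexp.sub_const (exp (-a * R ^ 2))).const_mul c)
    refine h.congr_of_eventuallyEq (Eventually.of_forall fun t => ?_)
    simp [hg]
  have hslope := (hasDerivAt_iff_tendsto_slope.1 hdg).mono_left
    (nhdsWithin_mono (0 : ℝ) (fun t (ht : t ∈ Ioi 0) => ne_of_gt ht))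
  have hge := ge_of_tendsto hslope (b := 0) (by
    filter_upwards [Ioo_mem_nhdsGT hR0] with t ht
    rw [slope_def_field, hg0, sub_zero, sub_zero]
    exact div_nonneg (hgnonneg t ht) ht.1.le)
  have : 0 < c * (exp (-a * R ^ 2) * (2 * a * R)) := by positivity
  linarith

theorem le_of_norm_eq (hv : IsBallSolution v L) {x y : E} (hx : ‖x‖ < 1) (hxy : ‖x‖ = ‖y‖) :
    v x ≤ v y := by
  rcases eq_or_ne x y with rfl | hne
  · exact le_rfl
  have hd : 0 < ‖x - y‖ := norm_pos_iff.2 (sub_ne_zero.2 hne)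
  set e : E := ‖x - y‖⁻¹ • (x - y) with he'
  have he : ‖e‖ = 1 := by
    rw [he', norm_smul, norm_inv, norm_norm, inv_mul_cancel₀ hd.ne']
  have hinner : ⟪e, x⟫_ℝ = ‖x - y‖ / 2 := by
    have h1 : ⟪x - y, x⟫_ℝ = ‖x - y‖ ^ 2 / 2 := by
      rw [norm_sub_sq_real, inner_sub_left, real_inner_self_eq_norm_sq, ← hxy, real_inner_comm]
      ring
    rw [he', real_inner_smul_left, h1]
    field_simp
  have hrefl : planeReflection e 0 x = y := by
    rw [planeReflection, hinner, he', smul_smul, sub_zero, mul_div_cancel₀ _ two_ne_zero,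
      mul_inv_cancel₀ hd.ne', one_smul, sub_sub_cancel]
  have hcont : Continuous fun r : ℝ => reflectionDiff v e r x :=
    (hv.continuous_reflectionDiff e).comp (by fun_prop : Continuous fun r : ℝ => (r, x))
  have hge : 0 ≤ reflectionDiff v e 0 x :=
    ge_of_tendsto ((hcont.tendsto 0).mono_left (nhdsWithin_le_nhds (s := Ioi 0))) (by
      filter_upwards [Ioo_mem_nhdsGT (half_pos hd)] with r hr
      exact hv.reflectionDiff_nonneg he hr.1 x ⟨hinner ▸ hr.2, hx⟩)
  rw [reflectionDiff, hrefl] at hge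
  linarith

end IsBallSolution

end MovingPlane

end MovingPlanes

open scoped Laplacian in
theorem lap_eq_laplacian {n : ℕ} (u : EuclideanSpace ℝ (Fin n) → ℝ) : lap u = Δ u := by
  rw [InnerProductSpace.laplacian_eq_iteratedFDeriv_orthonormalBasis u
    (EuclideanSpace.basisFun (Fin n) ℝ)]
  funext x
  simp [lap]

/- STATEMENT 9 (Gidas–Ni–Nirenberg): a positive classical solution of `-Δu = f(u)` on the
unit ball `B₁(0) ⊂ ℝⁿ`, vanishing on the boundary sphere, with `f` locally Lipschitz,
is radially symmetric and strictly radially decreasing (`∂u/∂r < 0` for `0 < |x| < 1`,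
expressed via the radial directional derivative `fderiv u x (x) < 0`). -/
theorem stmt9 (n : ℕ) (u : EuclideanSpace ℝ (Fin n) → ℝ) (f : ℝ → ℝ)
    (hf : LocallyLipschitz f)
    (hu : ContDiffOn ℝ 2 u (Metric.closedBall (0 : EuclideanSpace ℝ (Fin n)) 1))
    (hucont : ContinuousOn u (Metric.closedBall (0 : EuclideanSpace ℝ (Fin n)) 1))
    (hpos : ∀ x ∈ Metric.ball (0 : EuclideanSpace ℝ (Fin n)) 1, 0 < u x)
    (hbdry : ∀ x : EuclideanSpace ℝ (Fin n), ‖x‖ = 1 → u x = 0)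
    (heq : ∀ x ∈ Metric.ball (0 : EuclideanSpace ℝ (Fin n)) 1, -lap u x = f (u x)) :
    (∀ x y : EuclideanSpace ℝ (Fin n), x ∈ Metric.ball (0 : EuclideanSpace ℝ (Fin n)) 1 →
      y ∈ Metric.ball (0 : EuclideanSpace ℝ (Fin n)) 1 → ‖x‖ = ‖y‖ → u x = u y) ∧
    (∀ x : EuclideanSpace ℝ (Fin n), 0 < ‖x‖ → ‖x‖ < 1 → fderiv ℝ u x x < 0) := by
  obtain ⟨L, hL, hLip⟩ : ∃ L > 0, ∀ x y, ‖x‖ < 1 → ‖y‖ < 1 →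
      |f (u x) - f (u y)| ≤ L * |u x - u y| := by
    have hcomp : IsCompact (u '' Metric.closedBall 0 1) :=
      (isCompact_closedBall 0 1).image_of_continuousOn hucont
    obtain ⟨K, hK⟩ := LocallyLipschitzOn.exists_lipschitzOnWith_of_compact hcomp
      hf.locallyLipschitzOn
    refine ⟨K + 1, by positivity, fun x y hx hy => ?_⟩
    have h := hK.dist_le_mul (u x) ⟨x, by simpa using hx.le, rfl⟩ (u y)
      ⟨y, by simpa using hy.le, rfl⟩
    rw [Real.dist_eq, Real.dist_eq] at h
    nlinarith [abs_nonneg (u x - u y)]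
  set v := (Metric.closedBall (0 : EuclideanSpace ℝ (Fin n)) 1).indicator u with hv
  have hball : ∀ x : EuclideanSpace ℝ (Fin n), ‖x‖ < 1 → Metric.closedBall 0 1 ∈ nhds x :=
    fun x hx => Filter.mem_of_superset (Metric.isOpen_ball.mem_nhds (by simpa using hx))
      Metric.ball_subset_closedBall
  have hvu : ∀ x, ‖x‖ < 1 → v =ᶠ[nhds x] u := fun x hx => by
    filter_upwards [hball x hx] with y hy
    exact Set.indicator_of_mem hy u
  have hvΔ : ∀ x, ‖x‖ < 1 → Laplacian.laplacian v x = -f (u x) := fun x hx => by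
    rw [(InnerProductSpace.laplacian_congr_nhds (hvu x hx)).eq_of_nhds, ← lap_eq_laplacian,
      ← heq x (by simpa using hx), neg_neg]
  have hsol : MovingPlanes.IsBallSolution v L := by
    refine ⟨?_, ?_, ?_, ?_, hL, ?_⟩
    · refine continuous_indicator (fun x hx => hbdry x ?_)
        (by rwa [Metric.isClosed_closedBall.closure_eq])
      simpa using Metric.frontier_closedBall_subset_sphere hx
    · intro x hx
      rcases hx.eq_or_lt with h | h
      · rw [hv, Set.indicator_of_mem (by simp [← h]), hbdry x h.symm]
      · exact Set.indicator_of_notMem (by simpa using h) u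
    · intro x hx
      rw [(hvu x hx).eq_of_nhds]
      exact hpos x (by simpa using hx)
    · intro x hx
      exact (hu.contDiffAt (hball x hx)).congr_of_eventuallyEq (hvu x hx)
    · intro x y hx hy
      rw [hvΔ x hx, hvΔ y hy, (hvu x hx).eq_of_nhds, (hvu y hy).eq_of_nhds, neg_sub_neg,
        abs_sub_comm]
      exact hLip x y hx hy
  constructor
  · intro x y hx hy hxy
    rw [mem_ball_zero_iff] at hx hy
    rw [← (hvu x hx).eq_of_nhds, ← (hvu y hy).eq_of_nhds]
    exact le_antisymm (hsol.le_of_norm_eq hx hxy) (hsol.le_of_norm_eq hy hxy.symm)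
  · intro x hx0 hx1
    rw [← (hvu x hx1).fderiv_eq]
    have he : ‖‖x‖⁻¹ • x‖ = 1 := by rw [norm_smul, norm_inv, norm_norm, inv_mul_cancel₀ hx0.ne']
    have h := hsol.fderiv_neg he hx1 (by
      rw [real_inner_smul_left, real_inner_self_eq_norm_sq]
      positivity)
    rw [map_smul, smul_eq_mul] at h
    exact neg_of_mul_neg_right h (inv_nonneg.2 hx0.le)
end

section
/- (Korevaar–Mazzeo–Pacard–Schoen Harnack-type inequality) Let Ω ⊂ ℝⁿ, n ≥ 3, be open and K ⊂ Ω compact. There exists c = c(K, n, Ω) such that every positive C² solution u of -Δu = u^{(n+2)/(n-2)} in Ω satisfies (sup_K u) · (inf_Ω u) ≤ c. -/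
open MeasureTheory Real

open Filter Topology Set

/-! ### One-variable calculus -/

/-- The necessary second-order condition at a local minimum. -/
theorem IsLocalMin.nonneg_of_hasDerivAt_hasDerivAt {φ φ' : ℝ → ℝ} {t c : ℝ}
    (hmin : IsLocalMin φ t) (hφ : ∀ᶠ s in 𝓝 t, HasDerivAt φ (φ' s) s)
    (hφ' : HasDerivAt φ' c t) : 0 ≤ c := by
  by_contra! hc
  have hd : deriv φ =ᶠ[𝓝 t] φ' := hφ.mono fun s hs => hs.deriv
  have hdd : deriv (deriv φ) t = c := by rw [hd.deriv_eq, hφ'.deriv]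
  have hmax : IsLocalMax φ t := isLocalMax_of_deriv_deriv_neg (by rwa [hdd]) hmin.deriv_eq_zero
    hφ.self_of_nhds.continuousAt
  have hconst : φ =ᶠ[𝓝 t] fun _ => φ t := by
    filter_upwards [hmin, hmax] with s h₁ h₂ using le_antisymm h₂ h₁
  have : deriv (deriv φ) t = 0 := by
    rw [(hconst.deriv).deriv_eq]
    simp
  linarith

theorem HasDerivAt.nonneg_of_eventually_nonneg_right {φ : ℝ → ℝ} {c t : ℝ}
    (h : HasDerivAt φ c t) (h₀ : φ t = 0) (hpos : ∀ᶠ s in 𝓝[>] t, 0 ≤ φ s) : 0 ≤ c := by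
  have hs := (hasDerivAt_iff_tendsto_slope.1 h).mono_left
    (nhdsWithin_mono t (s := Ioi t) fun s (hs : t < s) => ne_of_gt hs)
  refine ge_of_tendsto hs ?_
  filter_upwards [hpos, self_mem_nhdsWithin] with s h₁ h₂
  rw [slope_def_field, h₀, sub_zero]
  exact div_nonneg h₁ (sub_nonneg.2 (le_of_lt h₂))

/-! ### Second derivatives along rays and circles -/

section Curves

variable {E : Type*} [NormedAddCommGroup E] [NormedSpace ℝ E]

theorem hasDerivAt_ray (x θ : E) (t : ℝ) :
    HasDerivAt (fun t : ℝ => x + exp t • θ) (exp t • θ) t := by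
  simpa using ((Real.hasDerivAt_exp t).smul_const θ).const_add x

theorem hasDerivAt_circle (x θ e : E) (r τ : ℝ) :
    HasDerivAt (fun τ : ℝ => x + r • (cos τ • θ + sin τ • e))
      (r • (-sin τ • θ + cos τ • e)) τ :=
  (((((Real.hasDerivAt_cos τ).smul_const θ).add
    ((Real.hasDerivAt_sin τ).smul_const e)).const_smul r).const_add x)

/-- The function `u` in logarithmic polar coordinates about `x`, with conformal weight `a`. -/
noncomputable def cyl (a : ℝ) (u : E → ℝ) (x : E) (t : ℝ) (θ : E) : ℝ :=
  exp (a * t) * u (x + exp t • θ)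

/-- The derivative of `cyl a u x t θ` in `t`. -/
noncomputable def cylDeriv (a : ℝ) (u : E → ℝ) (x : E) (t : ℝ) (θ : E) : ℝ :=
  exp (a * t) * (a * u (x + exp t • θ) + fderiv ℝ u (x + exp t • θ) (exp t • θ))

/-- The second derivative of `cyl a u x t θ` in `t`. -/
noncomputable def cylDeriv₂ (a : ℝ) (u : E → ℝ) (x : E) (t : ℝ) (θ : E) : ℝ :=
  exp (a * t) * (a ^ 2 * u (x + exp t • θ)
    + (2 * a + 1) * fderiv ℝ u (x + exp t • θ) (exp t • θ)
    + fderiv ℝ (fderiv ℝ u) (x + exp t • θ) (exp t • θ) (exp t • θ))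

variable {u : E → ℝ} {x θ e : E} {t : ℝ}

theorem ContDiffAt.differentiableAt_fderiv {y : E} (h : ContDiffAt ℝ 2 u y) :
    DifferentiableAt ℝ (fderiv ℝ u) y :=
  (h.fderiv_right (m := 1) (by norm_num)).differentiableAt one_ne_zero

theorem ContDiffAt.differentiableAt_two {y : E} (h : ContDiffAt ℝ 2 u y) :
    DifferentiableAt ℝ u y :=
  h.differentiableAt two_ne_zero

theorem hasDerivAt_exp_mul_const (a t : ℝ) :
    HasDerivAt (fun t => exp (a * t)) (a * exp (a * t)) t := by
  simpa [mul_comm] using ((hasDerivAt_id t).const_mul a).exp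

theorem hasDerivAt_cyl (a : ℝ) (h : DifferentiableAt ℝ u (x + exp t • θ)) :
    HasDerivAt (fun t => cyl a u x t θ) (cylDeriv a u x t θ) t := by
  have h₁ := h.hasFDerivAt.comp_hasDerivAt t (hasDerivAt_ray x θ t)
  refine ((hasDerivAt_exp_mul_const a t).mul h₁).congr_deriv ?_
  simp only [cylDeriv, Function.comp_apply]
  ring

theorem hasDerivAt_cylDeriv (a : ℝ) (h : ContDiffAt ℝ 2 u (x + exp t • θ)) :
    HasDerivAt (fun t => cylDeriv a u x t θ) (cylDeriv₂ a u x t θ) t := by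
  have h₁ : HasDerivAt (fun t => u (x + exp t • θ))
      (fderiv ℝ u (x + exp t • θ) (exp t • θ)) t :=
    (h.differentiableAt two_ne_zero).hasFDerivAt.comp_hasDerivAt t (hasDerivAt_ray x θ t)
  have h₂ : HasDerivAt (fun t => fderiv ℝ u (x + exp t • θ))
      (fderiv ℝ (fderiv ℝ u) (x + exp t • θ) (exp t • θ)) t :=
    h.differentiableAt_fderiv.hasFDerivAt.comp_hasDerivAt t (hasDerivAt_ray x θ t)
  have h₃ : HasDerivAt (fun t => fderiv ℝ u (x + exp t • θ) (exp t • θ))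
      (fderiv ℝ (fderiv ℝ u) (x + exp t • θ) (exp t • θ) (exp t • θ)
        + fderiv ℝ u (x + exp t • θ) (exp t • θ)) t :=
    h₂.clm_apply ((Real.hasDerivAt_exp t).smul_const θ)
  unfold cylDeriv cylDeriv₂
  have h₄ := (hasDerivAt_exp_mul_const a t).fun_mul ((h₁.const_mul a).fun_add h₃)
  refine h₄.congr_deriv ?_
  generalize fderiv ℝ (fderiv ℝ u) (x + exp t • θ) (exp t • θ) (exp t • θ) = A
  generalize fderiv ℝ u (x + exp t • θ) (exp t • θ) = B
  ring

theorem hasDerivAt_comp_circle (r τ : ℝ)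
    (h : DifferentiableAt ℝ u (x + r • (cos τ • θ + sin τ • e))) :
    HasDerivAt (fun τ => u (x + r • (cos τ • θ + sin τ • e)))
      (fderiv ℝ u (x + r • (cos τ • θ + sin τ • e)) (r • (-sin τ • θ + cos τ • e))) τ :=
  HasFDerivAt.comp_hasDerivAt (f := fun τ => x + r • (cos τ • θ + sin τ • e)) τ
    h.hasFDerivAt (hasDerivAt_circle x θ e r τ)

theorem hasDerivAt_deriv_comp_circle (r : ℝ) (h : ContDiffAt ℝ 2 u (x + r • θ)) :
    HasDerivAt
      (fun τ => fderiv ℝ u (x + r • (cos τ • θ + sin τ • e)) (r • (-sin τ • θ + cos τ • e)))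
      (fderiv ℝ (fderiv ℝ u) (x + r • θ) (r • e) (r • e) - fderiv ℝ u (x + r • θ) (r • θ)) 0 := by
  have hγ := hasDerivAt_circle x θ e r 0
  have hγ' : HasDerivAt (fun τ : ℝ => r • (-sin τ • θ + cos τ • e))
      (r • (-cos 0 • θ + -sin 0 • e)) 0 :=
    (((((Real.hasDerivAt_sin 0).neg).smul_const θ).add
      ((Real.hasDerivAt_cos 0).smul_const e)).const_smul r)
  have h₀ : x + r • (cos 0 • θ + sin 0 • e) = x + r • θ := by simp
  have hd : HasFDerivAt (fderiv ℝ u) (fderiv ℝ (fderiv ℝ u) (x + r • θ))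
      (x + r • (cos 0 • θ + sin 0 • e)) := by
    rw [h₀]; exact h.differentiableAt_fderiv.hasFDerivAt
  have h₃ := (HasFDerivAt.comp_hasDerivAt (f := fun τ => x + r • (cos τ • θ + sin τ • e)) 0
    hd hγ).clm_apply hγ'
  refine h₃.congr_deriv ?_
  simp [sub_eq_add_neg]

end Curves

/-! ### The equation in logarithmic polar coordinates -/

theorem lap_eq_sum_orthonormalBasis {n : ℕ} (u : EuclideanSpace ℝ (Fin n) → ℝ)
    (y : EuclideanSpace ℝ (Fin n)) (b : OrthonormalBasis (Fin n) ℝ (EuclideanSpace ℝ (Fin n))) :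
    lap u y = ∑ i, fderiv ℝ (fderiv ℝ u) y (b i) (b i) := by
  have h₁ := congrFun
    (InnerProductSpace.laplacian_eq_iteratedFDeriv_orthonormalBasis u b) y
  have h₂ := congrFun (InnerProductSpace.laplacian_eq_iteratedFDeriv_orthonormalBasis u
    (EuclideanSpace.basisFun (Fin n) ℝ)) y
  simp only [EuclideanSpace.basisFun_apply] at h₂
  rw [lap, ← h₂, h₁]
  simp [iteratedFDeriv_two_apply]

theorem cylDeriv₂_add_sum {n : ℕ} {u : EuclideanSpace ℝ (Fin n) → ℝ}
    (x : EuclideanSpace ℝ (Fin n)) (t : ℝ)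
    (b : OrthonormalBasis (Fin n) ℝ (EuclideanSpace ℝ (Fin n))) (i₀ : Fin n) :
    cylDeriv₂ (((n : ℝ) - 2) / 2) u x t (b i₀)
      + ∑ i ∈ Finset.univ.erase i₀, exp (((n : ℝ) - 2) / 2 * t) *
        (fderiv ℝ (fderiv ℝ u) (x + exp t • b i₀) (exp t • b i) (exp t • b i)
          - fderiv ℝ u (x + exp t • b i₀) (exp t • b i₀))
      = (((n : ℝ) - 2) / 2) ^ 2 * cyl (((n : ℝ) - 2) / 2) u x t (b i₀)
        + exp (((n : ℝ) - 2) / 2 * t) * (exp t ^ 2 * lap u (x + exp t • b i₀)) := by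
  have hn : 1 ≤ n := i₀.pos
  rw [lap_eq_sum_orthonormalBasis u _ b, ← Finset.add_sum_erase _ _ (Finset.mem_univ i₀),
    ← Finset.mul_sum, Finset.sum_sub_distrib, Finset.sum_const, Finset.card_erase_of_mem
    (Finset.mem_univ i₀), Finset.card_univ, Fintype.card_fin, nsmul_eq_mul, Nat.cast_sub hn]
  simp only [map_smul, smul_apply, smul_eq_mul, ← Finset.mul_sum, cylDeriv₂,
    cyl, ← mul_assoc (exp t) (exp t)]
  generalize ∑ i ∈ Finset.univ.erase i₀,
    fderiv ℝ (fderiv ℝ u) (x + exp t • b i₀) (b i) (b i) = A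
  push_cast
  ring

/-- Positive `C²` solutions of `-Δu = u^{(n+2)/(n-2)}` on an open set. -/
structure IsYamabeSolution {n : ℕ} (u : EuclideanSpace ℝ (Fin n) → ℝ)
    (Ω : Set (EuclideanSpace ℝ (Fin n))) : Prop where
  isOpen : IsOpen Ω
  contDiffOn : ContDiffOn ℝ 2 u Ω
  pos : ∀ x ∈ Ω, 0 < u x
  neg_lap_eq : ∀ x ∈ Ω, -lap u x = u x ^ (((n : ℝ) + 2) / ((n : ℝ) - 2))

section Continuity

variable {E : Type*} [NormedAddCommGroup E] [NormedSpace ℝ E] {u : E → ℝ} {x : E}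

theorem continuousAt_cyl (a : ℝ) {z : ℝ × E} (h : ContinuousAt u (x + exp z.1 • z.2)) :
    ContinuousAt (fun z : ℝ × E => cyl a u x z.1 z.2) z := by
  unfold cyl
  refine ContinuousAt.mul (by fun_prop) ?_
  exact ContinuousAt.comp (f := fun z : ℝ × E => x + exp z.1 • z.2) h (by fun_prop)

theorem continuousAt_cylDeriv (a : ℝ) {z : ℝ × E} (h : ContDiffAt ℝ 2 u (x + exp z.1 • z.2)) :
    ContinuousAt (fun z : ℝ × E => cylDeriv a u x z.1 z.2) z := by
  unfold cylDeriv
  have h₀ : ContinuousAt (fun z : ℝ × E => x + exp z.1 • z.2) z := by fun_prop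
  have h₁ : ContinuousAt (fun z : ℝ × E => u (x + exp z.1 • z.2)) z :=
    ContinuousAt.comp (f := fun z : ℝ × E => x + exp z.1 • z.2) h.continuousAt h₀
  have h₂ : ContinuousAt (fun z : ℝ × E => fderiv ℝ u (x + exp z.1 • z.2)) z :=
    ContinuousAt.comp (f := fun z : ℝ × E => x + exp z.1 • z.2)
      h.differentiableAt_fderiv.continuousAt h₀
  have h₃ : ContinuousAt (fun z : ℝ × E => exp z.1 • z.2) z := by fun_prop
  exact ContinuousAt.mul (by fun_prop) ((h₁.const_mul a).add (h₂.clm_apply h₃))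

end Continuity

section Reflection

variable {n : ℕ} {u : EuclideanSpace ℝ (Fin n) → ℝ} {Ω : Set (EuclideanSpace ℝ (Fin n))}
  {x θ : EuclideanSpace ℝ (Fin n)} {s t T ε : ℝ}

theorem IsYamabeSolution.contDiffAt (h : IsYamabeSolution u Ω) {y : EuclideanSpace ℝ (Fin n)}
    (hy : y ∈ Ω) : ContDiffAt ℝ 2 u y :=
  h.contDiffOn.contDiffAt (h.isOpen.mem_nhds hy)

theorem ray_mem (hT : Metric.closedBall x (exp T) ⊆ Ω) (ht : t ≤ T)
    (hθ : θ ∈ Metric.sphere (0 : EuclideanSpace ℝ (Fin n)) 1) : x + exp t • θ ∈ Ω := by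
  apply hT
  rw [mem_sphere_zero_iff_norm] at hθ
  simpa [norm_smul, hθ, abs_of_pos (exp_pos t)] using ht

theorem IsYamabeSolution.cyl_pos (h : IsYamabeSolution u Ω) (a : ℝ)
    (hx : x + exp t • θ ∈ Ω) : 0 < cyl a u x t θ :=
  mul_pos (exp_pos _) (h.pos _ hx)

theorem IsYamabeSolution.exp_mul_lap (h : IsYamabeSolution u Ω) (hn : 3 ≤ n)
    (hx : x + exp t • θ ∈ Ω) :
    exp (((n : ℝ) - 2) / 2 * t) * (exp t ^ 2 * lap u (x + exp t • θ))
      = -cyl (((n : ℝ) - 2) / 2) u x t θ ^ (((n : ℝ) + 2) / ((n : ℝ) - 2)) := by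
  have hn' : (3 : ℝ) ≤ n := by exact_mod_cast hn
  rw [cyl, Real.mul_rpow (exp_pos _).le (h.pos _ hx).le, ← h.neg_lap_eq _ hx, ← Real.exp_mul,
    ← Real.exp_nat_mul, ← mul_assoc, ← Real.exp_add]
  have : ((n : ℝ) - 2) / 2 * t * (((n : ℝ) + 2) / ((n : ℝ) - 2))
      = ((n : ℝ) - 2) / 2 * t + ((2 : ℕ) : ℝ) * t := by
    have : (n : ℝ) - 2 ≠ 0 := by linarith
    field_simp
    push_cast
    ring
  rw [this]
  ring

theorem exists_orthonormalBasis_apply_eq (i₀ : Fin n)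
    (hθ : θ ∈ Metric.sphere (0 : EuclideanSpace ℝ (Fin n)) 1) :
    ∃ b : OrthonormalBasis (Fin n) ℝ (EuclideanSpace ℝ (Fin n)), b i₀ = θ := by
  rw [mem_sphere_zero_iff_norm] at hθ
  obtain ⟨b, hb⟩ := Orthonormal.exists_orthonormalBasis_extension_of_card_eq (𝕜 := ℝ)
    (E := EuclideanSpace ℝ (Fin n)) (ι := Fin n) (by simp) (v := fun _ => θ) (s := {i₀})
    ⟨fun _ => by simpa using hθ, fun i j hij => (hij (Subsingleton.elim i j)).elim⟩
  exact ⟨b, hb i₀ rfl⟩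

/-- A quantitative maximum principle for the reflected difference. -/
theorem IsYamabeSolution.reflection_add_sinh_le (h : IsYamabeSolution u Ω) (hn : 3 ≤ n)
    (hΩ : Metric.closedBall x (exp T) ⊆ Ω)
    (hle : ∀ t ∈ Icc s T, ∀ θ ∈ Metric.sphere (0 : EuclideanSpace ℝ (Fin n)) 1,
      cyl (((n : ℝ) - 2) / 2) u x (2 * s - t) θ ≤ cyl (((n : ℝ) - 2) / 2) u x t θ)
    (hT : ∀ θ ∈ Metric.sphere (0 : EuclideanSpace ℝ (Fin n)) 1,
      cyl (((n : ℝ) - 2) / 2) u x (2 * s - T) θ + ε * sinh (((n : ℝ) - 2) / 2 * (T - s))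
        ≤ cyl (((n : ℝ) - 2) / 2) u x T θ)
    (ht : t ∈ Icc s T) (hθ : θ ∈ Metric.sphere (0 : EuclideanSpace ℝ (Fin n)) 1) :
    cyl (((n : ℝ) - 2) / 2) u x (2 * s - t) θ + ε * sinh (((n : ℝ) - 2) / 2 * (t - s))
      ≤ cyl (((n : ℝ) - 2) / 2) u x t θ := by
  set a : ℝ := ((n : ℝ) - 2) / 2 with ha
  have hn' : (3 : ℝ) ≤ n := by exact_mod_cast hn
  have ha₀ : 0 < a := by rw [ha]; linarith
  set Φ : ℝ × EuclideanSpace ℝ (Fin n) → ℝ := fun z =>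
    cyl a u x z.1 z.2 - cyl a u x (2 * s - z.1) z.2 - ε * sinh (a * (z.1 - s)) with hΦ
  have hcpt : IsCompact (Icc s T ×ˢ Metric.sphere (0 : EuclideanSpace ℝ (Fin n)) 1) :=
    isCompact_Icc.prod (isCompact_sphere _ _)
  have hcont : ContinuousOn Φ (Icc s T ×ˢ Metric.sphere (0 : EuclideanSpace ℝ (Fin n)) 1) := by
    rintro ⟨t, θ⟩ ⟨ht, hθ⟩
    have h₁ := continuousAt_cyl a (z := (t, θ)) (x := x)
      (h.contDiffAt (ray_mem hΩ ht.2 hθ)).continuousAt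
    have h₂ := continuousAt_cyl a (z := (2 * s - t, θ)) (x := x)
      (h.contDiffAt (ray_mem hΩ (by have := ht.1; have := ht.2; simp only at *; linarith)
        hθ)).continuousAt
    have h₃ : ContinuousAt (fun z : ℝ × EuclideanSpace ℝ (Fin n) =>
        cyl a u x (2 * s - z.1) z.2) (t, θ) :=
      ContinuousAt.comp (x := (t, θ)) (g := fun z => cyl a u x z.1 z.2)
        (f := fun z : ℝ × EuclideanSpace ℝ (Fin n) => (2 * s - z.1, z.2)) h₂ (by fun_prop)
    have h₄ : ContinuousAt (fun z : ℝ × EuclideanSpace ℝ (Fin n) =>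
        ε * sinh (a * (z.1 - s))) (t, θ) := by fun_prop
    exact ((h₁.sub h₃).sub h₄).continuousWithinAt
  obtain ⟨⟨t₀, θ₀⟩, ⟨ht₀, hθ₀⟩, hmin⟩ := hcpt.exists_isMinOn ⟨(t, θ), ht, hθ⟩ hcont
  simp only at ht₀ hθ₀
  suffices hpos : 0 ≤ Φ (t₀, θ₀) by
    have := hpos.trans (hmin (show (t, θ) ∈ _ from ⟨ht, hθ⟩))
    simp only [hΦ] at this
    linarith
  rcases ht₀.1.eq_or_lt with rfl | hs
  · simp [hΦ, two_mul]
  rcases ht₀.2.eq_or_lt with rfl | hT'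
  · have := hT θ₀ hθ₀
    simp only [hΦ]
    linarith
  have hm₁ : x + exp t₀ • θ₀ ∈ Ω := ray_mem hΩ ht₀.2 hθ₀
  have hm₂ : x + exp (2 * s - t₀) • θ₀ ∈ Ω := ray_mem hΩ (by linarith) hθ₀
  have hevt : ∀ᶠ t in 𝓝 t₀, t ∈ Icc s T := Icc_mem_nhds hs hT'
  obtain ⟨b, hb⟩ := exists_orthonormalBasis_apply_eq (⟨0, by omega⟩ : Fin n) hθ₀
  set i₀ : Fin n := ⟨0, by omega⟩
  have hrad : 0 ≤ cylDeriv₂ a u x t₀ θ₀ - cylDeriv₂ a u x (2 * s - t₀) θ₀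
      - ε * (a ^ 2 * sinh (a * (t₀ - s))) := by
    have hloc : IsLocalMin (fun t => Φ (t, θ₀)) t₀ := by
      filter_upwards [hevt] with t ht using hmin (show (t, θ₀) ∈ _ from ⟨ht, hθ₀⟩)
    have hlin : ∀ t, HasDerivAt (fun t => a * (t - s)) a t := fun t => by
      simpa using ((hasDerivAt_id t).sub_const s).const_mul a
    refine hloc.nonneg_of_hasDerivAt_hasDerivAt
      (φ' := fun t => cylDeriv a u x t θ₀ + cylDeriv a u x (2 * s - t) θ₀
        - ε * (cosh (a * (t - s)) * a)) ?_ ?_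
    · filter_upwards [hevt] with t ht
      have h₁ := hasDerivAt_cyl a (h.contDiffAt (ray_mem hΩ ht.2 hθ₀)).differentiableAt_two
      have h₂ := (hasDerivAt_cyl a (h.contDiffAt (ray_mem (t := 2 * s - t) hΩ
        (by linarith [ht.1, ht.2]) hθ₀)).differentiableAt_two).comp_const_sub (2 * s) t
      have h₃ := ((hlin t).sinh).const_mul ε
      exact ((h₁.sub h₂).sub h₃).congr_deriv (by ring)
    · have h₁ := hasDerivAt_cylDeriv a (h.contDiffAt hm₁)
      have h₂ := (hasDerivAt_cylDeriv a (h.contDiffAt hm₂)).comp_const_sub (2 * s) t₀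
      have h₃ := (((hlin t₀).cosh).mul_const a).const_mul ε
      exact ((h₁.add h₂).sub h₃).congr_deriv (by ring)
  have hang : ∀ i ∈ Finset.univ.erase i₀,
      exp (a * (2 * s - t₀)) *
        (fderiv ℝ (fderiv ℝ u) (x + exp (2 * s - t₀) • b i₀) (exp (2 * s - t₀) • b i)
          (exp (2 * s - t₀) • b i)
          - fderiv ℝ u (x + exp (2 * s - t₀) • b i₀) (exp (2 * s - t₀) • b i₀)) ≤
      exp (a * t₀) *
        (fderiv ℝ (fderiv ℝ u) (x + exp t₀ • b i₀) (exp t₀ • b i) (exp t₀ • b i)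
          - fderiv ℝ u (x + exp t₀ • b i₀) (exp t₀ • b i₀)) := by
    intro i hi
    rw [hb]
    have hsph : ∀ τ : ℝ, cos τ • θ₀ + sin τ • b i ∈
        Metric.sphere (0 : EuclideanSpace ℝ (Fin n)) 1 := by
      intro τ
      have horth : inner ℝ (cos τ • θ₀) (sin τ • b i) = 0 := by
        rw [inner_smul_left, inner_smul_right, ← hb,
          b.inner_eq_zero (Finset.ne_of_mem_erase hi).symm]
        simp
      have := norm_add_sq_eq_norm_sq_add_norm_sq_of_inner_eq_zero _ _ horth
      rw [mem_sphere_zero_iff_norm] at hθ₀ ⊢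
      simp only [norm_smul, hθ₀, b.norm_eq_one, mul_one, Real.norm_eq_abs,
        abs_mul_abs_self] at this
      have h₁ : ‖cos τ • θ₀ + sin τ • b i‖ * ‖cos τ • θ₀ + sin τ • b i‖ = 1 := by
        rw [this]; nlinarith [sin_sq_add_cos_sq τ]
      nlinarith [norm_nonneg (cos τ • θ₀ + sin τ • b i)]
    have hloc : IsLocalMin (fun τ : ℝ => Φ (t₀, cos τ • θ₀ + sin τ • b i)) 0 := by
      refine Eventually.of_forall fun τ => ?_
      simpa using hmin (show (t₀, cos τ • θ₀ + sin τ • b i) ∈ _ from ⟨ht₀, hsph τ⟩)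
    have hd : ∀ t ≤ T, ∀ τ, HasDerivAt (fun τ => cyl a u x t (cos τ • θ₀ + sin τ • b i))
        (exp (a * t) * fderiv ℝ u (x + exp t • (cos τ • θ₀ + sin τ • b i))
          (exp t • (-sin τ • θ₀ + cos τ • b i))) τ := fun t ht τ =>
      (hasDerivAt_comp_circle (exp t) τ
        (h.contDiffAt (ray_mem hΩ ht (hsph τ))).differentiableAt_two).const_mul _
    have hs₀ : 2 * s - t₀ ≤ T := by linarith
    have key := hloc.nonneg_of_hasDerivAt_hasDerivAt
      (Eventually.of_forall fun τ => ((hd t₀ ht₀.2 τ).fun_sub (hd _ hs₀ τ)).sub_const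
        (ε * sinh (a * (t₀ - s))))
      (((hasDerivAt_deriv_comp_circle (e := b i) (exp t₀) (h.contDiffAt hm₁)).const_mul
        (exp (a * t₀))).fun_sub ((hasDerivAt_deriv_comp_circle (e := b i) (exp (2 * s - t₀))
          (h.contDiffAt hm₂)).const_mul (exp (a * (2 * s - t₀)))))
    linarith
  have hsum := Finset.sum_le_sum hang
  have e₁ := cylDeriv₂_add_sum (u := u) x t₀ b i₀
  have e₂ := cylDeriv₂_add_sum (u := u) x (2 * s - t₀) b i₀
  rw [← ha, hb] at e₁ e₂
  rw [hb] at hsum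
  rw [ha, h.exp_mul_lap hn hm₁, ← ha] at e₁
  rw [ha, h.exp_mul_lap hn hm₂, ← ha] at e₂
  have hp : 0 ≤ ((n : ℝ) + 2) / ((n : ℝ) - 2) := div_nonneg (by linarith) (by linarith)
  have hpow := Real.rpow_le_rpow (h.cyl_pos a hm₂).le (hle t₀ ht₀ θ₀ hθ₀) hp
  have : 0 ≤ a ^ 2 * Φ (t₀, θ₀) := by
    simp only [hΦ]
    linarith
  exact nonneg_of_mul_nonneg_right this (by positivity)

end Reflection

/-! ### Moving spheres -/

section MovingSpheres

variable {n : ℕ} {u : EuclideanSpace ℝ (Fin n) → ℝ} {Ω : Set (EuclideanSpace ℝ (Fin n))}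
  {x θ : EuclideanSpace ℝ (Fin n)} {s s₁ T δ : ℝ}

/-- `u` dominates its Kelvin transform in the sphere of radius `exp s` about `x`, on the annulus
between this sphere and the one of radius `exp T`. -/
def ReflectionLE (u : EuclideanSpace ℝ (Fin n) → ℝ) (x : EuclideanSpace ℝ (Fin n)) (T s : ℝ) :
    Prop :=
  ∀ t ∈ Icc s T, ∀ θ ∈ Metric.sphere (0 : EuclideanSpace ℝ (Fin n)) 1,
    cyl (((n : ℝ) - 2) / 2) u x (2 * s - t) θ ≤ cyl (((n : ℝ) - 2) / 2) u x t θ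

theorem IsYamabeSolution.exists_reflectionLE (h : IsYamabeSolution u Ω) (hn : 3 ≤ n)
    (hΩ : Metric.closedBall x (exp T) ⊆ Ω) (s₁ : ℝ) : ∃ s ≤ s₁, ReflectionLE u x T s := by
  have hn' : (3 : ℝ) ≤ n := by exact_mod_cast hn
  unfold ReflectionLE
  set a : ℝ := ((n : ℝ) - 2) / 2 with ha
  have ha₀ : 0 < a := by rw [ha]; linarith
  have hcpt := isCompact_closedBall x (exp T)
  have hne : (Metric.closedBall x (exp T)).Nonempty := ⟨x, by simp [(exp_pos T).le]⟩
  have hcont : ContinuousOn u (Metric.closedBall x (exp T)) := h.contDiffOn.continuousOn.mono hΩ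
  have hcont' : ContinuousOn (fderiv ℝ u) (Metric.closedBall x (exp T)) := fun y hy =>
    (h.contDiffAt (hΩ hy)).differentiableAt_fderiv.continuousAt.continuousWithinAt
  obtain ⟨y₁, hy₁, hmin⟩ := hcpt.exists_isMinOn hne hcont
  obtain ⟨y₂, hy₂, hmax⟩ := hcpt.exists_isMaxOn hne hcont
  obtain ⟨D, hD⟩ := hcpt.exists_bound_of_continuousOn hcont'
  have hm : 0 < u y₁ := h.pos _ (hΩ hy₁)
  have hM : 0 < u y₂ := h.pos _ (hΩ hy₂)
  have hD₀ : 0 ≤ D := (norm_nonneg _).trans (hD x (by simp [(exp_pos T).le]))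
  have hball : ∀ t ≤ T, ∀ θ ∈ Metric.sphere (0 : EuclideanSpace ℝ (Fin n)) 1,
      x + exp t • θ ∈ Metric.closedBall x (exp T) := fun t ht θ hθ => ray_mem subset_rfl ht hθ
  set t₀ : ℝ := min T (log (a * u y₁ / (D + 1)))
  have ht₀ : exp t₀ * D ≤ a * u y₁ := by
    have h₁ : exp t₀ ≤ a * u y₁ / (D + 1) :=
      (exp_le_exp.2 (min_le_right _ _)).trans_eq (exp_log (by positivity))
    rw [le_div_iff₀ (by positivity)] at h₁
    nlinarith [exp_pos t₀]
  have ht₀T : t₀ ≤ T := min_le_left _ _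
  have hmono : ∀ θ ∈ Metric.sphere (0 : EuclideanSpace ℝ (Fin n)) 1,
      MonotoneOn (fun t => cyl a u x t θ) (Iic t₀) := by
    intro θ hθ
    have hder : ∀ t ≤ t₀, HasDerivAt (fun t => cyl a u x t θ) (cylDeriv a u x t θ) t :=
      fun t ht => hasDerivAt_cyl a
        (h.contDiffAt (hΩ (hball t (ht.trans ht₀T) θ hθ))).differentiableAt_two
    refine monotoneOn_of_deriv_nonneg (convex_Iic t₀)
      (fun t ht => (hder t ht).continuousAt.continuousWithinAt) ?_ ?_
    · intro t ht
      exact (hder t (show t ∈ Iic t₀ from interior_subset ht)).differentiableAt.differentiableWithinAt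
    · intro t ht
      have ht' : t ∈ Iic t₀ := interior_subset ht
      rw [mem_Iic] at ht'
      have hb := hball t (ht'.trans ht₀T) θ hθ
      rw [(hder t ht').deriv, cylDeriv]
      refine mul_nonneg (exp_pos _).le ?_
      have h₁ : u y₁ ≤ u (x + exp t • θ) := hmin hb
      have h₂ : ‖fderiv ℝ u (x + exp t • θ) (exp t • θ)‖ ≤ D * exp t := by
        refine ((fderiv ℝ u (x + exp t • θ)).le_opNorm _).trans ?_
        rw [mem_sphere_zero_iff_norm] at hθ
        rw [norm_smul, hθ, mul_one, Real.norm_eq_abs, abs_of_pos (exp_pos t)]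
        exact mul_le_mul_of_nonneg_right (hD _ hb) (exp_pos t).le
      have h₃ : exp t ≤ exp t₀ := exp_le_exp.2 ht'
      have h₄ := (abs_le.1 h₂).1
      nlinarith
  refine ⟨min s₁ (min t₀ (t₀ + log (u y₁ / u y₂) / (2 * a))), min_le_left _ _, ?_⟩
  set s := min s₁ (min t₀ (t₀ + log (u y₁ / u y₂) / (2 * a)))
  have hs₁ : s ≤ t₀ := (min_le_right _ _).trans (min_le_left _ _)
  have hs₂ : s ≤ t₀ + log (u y₁ / u y₂) / (2 * a) := (min_le_right _ _).trans (min_le_right _ _)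
  intro t ht θ hθ
  rcases le_total t t₀ with h₀ | h₀
  · exact hmono θ hθ (show 2 * s - t ≤ t₀ by linarith [ht.1]) h₀ (by linarith [ht.1])
  · have h₁ : u y₁ ≤ u (x + exp t • θ) := hmin (hball t ht.2 θ hθ)
    have h₂ : u (x + exp (2 * s - t) • θ) ≤ u y₂ := hmax (hball _ (by linarith [ht.1, ht.2]) θ hθ)
    have h₃ : a * (2 * s - t) ≤ a * t + log (u y₁ / u y₂) := by
      have : 2 * a * (s - t₀) ≤ log (u y₁ / u y₂) := by
        have := (le_div_iff₀ (by positivity)).1 (sub_le_iff_le_add'.2 hs₂)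
        linarith
      nlinarith
    calc cyl a u x (2 * s - t) θ ≤ exp (a * t + log (u y₁ / u y₂)) * u y₂ :=
          mul_le_mul (exp_le_exp.2 h₃) h₂ (h.pos _ (ray_mem hΩ (by linarith [ht.1, ht.2]) hθ)).le
            (exp_pos _).le
      _ = exp (a * t) * u y₁ := by
          rw [exp_add, exp_log (by positivity)]
          field_simp
      _ ≤ cyl a u x t θ := mul_le_mul_of_nonneg_left h₁ (exp_pos _).le

theorem IsYamabeSolution.cylDeriv_pos (h : IsYamabeSolution u Ω) (hn : 3 ≤ n)
    (hΩ : Metric.closedBall x (exp T) ⊆ Ω) (hs : s < T) (hδ : 0 < δ)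
    (hT : ∀ θ ∈ Metric.sphere (0 : EuclideanSpace ℝ (Fin n)) 1,
      cyl (((n : ℝ) - 2) / 2) u x (2 * s - T) θ + δ * sinh (((n : ℝ) - 2) / 2 * (T - s))
        ≤ cyl (((n : ℝ) - 2) / 2) u x T θ)
    (hP : ReflectionLE u x T s) (hθ : θ ∈ Metric.sphere (0 : EuclideanSpace ℝ (Fin n)) 1) :
    0 < cylDeriv (((n : ℝ) - 2) / 2) u x s θ := by
  have hn' : (3 : ℝ) ≤ n := by exact_mod_cast hn
  have key := fun t ht => h.reflection_add_sinh_le (t := t) hn hΩ hP hT ht hθ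
  set a : ℝ := ((n : ℝ) - 2) / 2 with ha
  have ha₀ : 0 < a := by rw [ha]; linarith
  have hlin : HasDerivAt (fun t => a * (t - s)) a s := by
    simpa using ((hasDerivAt_id s).sub_const s).const_mul a
  have hc := hasDerivAt_cyl a (h.contDiffAt (ray_mem hΩ hs.le hθ)).differentiableAt_two
  have hc' : HasDerivAt (fun t => cyl a u x (2 * s - t) θ) (-cylDeriv a u x s θ) s := by
    have : HasDerivAt (fun t => cyl a u x t θ) (cylDeriv a u x s θ) (2 * s - s) := by
      rwa [two_mul, add_sub_cancel_right]
    exact this.comp_const_sub (2 * s) s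
  have := ((hc.fun_sub hc').fun_sub (hlin.sinh.const_mul δ)).nonneg_of_eventually_nonneg_right
    (by simp [two_mul]) (by
      filter_upwards [Ioo_mem_nhdsGT hs] with t ht
      linarith [key t ⟨ht.1.le, ht.2.le⟩])
  simp only [sub_self, mul_zero, cosh_zero, one_mul, sub_neg_eq_add] at this
  nlinarith [mul_pos hδ ha₀]

theorem IsYamabeSolution.eventually_reflectionLE (h : IsYamabeSolution u Ω) (hn : 3 ≤ n)
    (hΩ : Metric.closedBall x (exp T) ⊆ Ω) (hs : s < T) (hδ : 0 < δ)
    (hT : ∀ θ ∈ Metric.sphere (0 : EuclideanSpace ℝ (Fin n)) 1,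
      cyl (((n : ℝ) - 2) / 2) u x (2 * s - T) θ + δ * sinh (((n : ℝ) - 2) / 2 * (T - s))
        ≤ cyl (((n : ℝ) - 2) / 2) u x T θ)
    (hP : ReflectionLE u x T s) : ∀ᶠ s' in 𝓝[>] s, ReflectionLE u x T s' := by
  have hn' : (3 : ℝ) ≤ n := by exact_mod_cast hn
  have key := fun t ht θ hθ => h.reflection_add_sinh_le (t := t) (θ := θ) hn hΩ hP hT ht hθ
  have hpos := fun θ hθ => h.cylDeriv_pos (θ := θ) hn hΩ hs hδ hT hP hθ
  unfold ReflectionLE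
  set a : ℝ := ((n : ℝ) - 2) / 2 with ha
  have ha₀ : 0 < a := by rw [ha]; linarith
  have hcpt : IsCompact (Icc s T ×ˢ Metric.sphere (0 : EuclideanSpace ℝ (Fin n)) 1) :=
    isCompact_Icc.prod (isCompact_sphere _ _)
  have hloc : ∀ᶠ s' in 𝓝 s, ∀ z ∈ Icc s T ×ˢ Metric.sphere (0 : EuclideanSpace ℝ (Fin n)) 1,
      s' ≤ z.1 → cyl a u x (2 * s' - z.1) z.2 ≤ cyl a u x z.1 z.2 := by
    refine hcpt.eventually_forall_of_forall_eventually ?_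
    rintro ⟨t, θ⟩ ⟨ht, hθ⟩
    simp only at ht hθ
    have hm := ray_mem hΩ ht.2 hθ
    rcases ht.1.eq_or_lt with rfl | hst
    · have hc := continuousAt_cylDeriv a (z := (s, θ)) (x := x) (h.contDiffAt hm)
      have hc' : ContinuousAt (fun z : ℝ × EuclideanSpace ℝ (Fin n) => x + exp z.1 • z.2)
        (s, θ) := by fun_prop
      obtain ⟨η, hη, hball⟩ := Metric.eventually_nhds_iff.1
        ((hc.eventually (lt_mem_nhds (hpos θ hθ))).and
          (hc'.eventually (h.isOpen.mem_nhds hm)))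
      filter_upwards [Metric.ball_mem_nhds ((s, (s, θ)) : ℝ × ℝ × EuclideanSpace ℝ (Fin n))
        (show 0 < η / 3 by positivity)] with w hw hle
      obtain ⟨s', t', θ'⟩ := w
      simp only [Metric.mem_ball, Prod.dist_eq, max_lt_iff, Real.dist_eq, abs_lt] at hw
      have hη' : ∀ τ ∈ Icc (2 * s' - t') t', dist (τ, θ') (s, θ) < η := by
        intro τ hτ
        simp only [Prod.dist_eq, max_lt_iff, Real.dist_eq, abs_lt]
        refine ⟨⟨by linarith [hτ.1], by linarith [hτ.2]⟩, by linarith [hw.2.2]⟩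
      have hder : ∀ τ ∈ Icc (2 * s' - t') t',
          HasDerivAt (fun t => cyl a u x t θ') (cylDeriv a u x τ θ') τ := fun τ hτ =>
        hasDerivAt_cyl a (h.contDiffAt (hball (hη' τ hτ)).2).differentiableAt_two
      have hle' : 2 * s' - t' ≤ t' := by simp only at hle; linarith
      refine monotoneOn_of_deriv_nonneg (convex_Icc (2 * s' - t') t')
        (fun τ hτ => (hder τ hτ).continuousAt.continuousWithinAt)
        (fun τ hτ => (hder τ (interior_subset hτ)).differentiableAt.differentiableWithinAt)
        (fun τ hτ => ?_) (left_mem_Icc.2 hle') (right_mem_Icc.2 hle') hle'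
      rw [(hder τ (interior_subset hτ)).deriv]
      exact (hball (hη' τ (interior_subset hτ))).1.le
    · have hlt : cyl a u x (2 * s - t) θ < cyl a u x t θ := by
        have := key t ht θ hθ
        have : 0 < δ * sinh (a * (t - s)) :=
          mul_pos hδ (sinh_pos_iff.2 (mul_pos ha₀ (sub_pos.2 hst)))
        linarith
      have hm' := ray_mem (t := 2 * s - t) hΩ (by linarith [ht.2]) hθ
      have h₁ : ContinuousAt (fun w : ℝ × ℝ × EuclideanSpace ℝ (Fin n) =>
          cyl a u x (2 * w.1 - w.2.1) w.2.2) (s, t, θ) :=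
        ContinuousAt.comp (x := (s, t, θ)) (g := fun z => cyl a u x z.1 z.2)
          (f := fun w : ℝ × ℝ × EuclideanSpace ℝ (Fin n) => (2 * w.1 - w.2.1, w.2.2))
          (continuousAt_cyl a (z := (2 * s - t, θ)) (h.contDiffAt hm').continuousAt) (by fun_prop)
      have h₂ : ContinuousAt (fun w : ℝ × ℝ × EuclideanSpace ℝ (Fin n) =>
          cyl a u x w.2.1 w.2.2) (s, t, θ) :=
        ContinuousAt.comp (x := (s, t, θ)) (g := fun z => cyl a u x z.1 z.2)
          (f := fun w : ℝ × ℝ × EuclideanSpace ℝ (Fin n) => w.2)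
          (continuousAt_cyl a (z := (t, θ)) (h.contDiffAt hm).continuousAt) (by fun_prop)
      filter_upwards [h₁.eventually_lt h₂ hlt] with w hw _ using hw.le
  filter_upwards [nhdsWithin_le_nhds hloc, self_mem_nhdsWithin] with s' hs' hss t ht θ hθ
  exact hs' (t, θ) ⟨⟨(le_of_lt hss).trans ht.1, ht.2⟩, hθ⟩ ht.1

/-- The method of moving spheres: as long as the boundary inequality is strict, the inequality
between `u` and its Kelvin transforms persists up to radius `exp s₁`. -/
theorem IsYamabeSolution.reflectionLE (h : IsYamabeSolution u Ω) (hn : 3 ≤ n)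
    (hΩ : Metric.closedBall x (exp T) ⊆ Ω) (hs₁ : s₁ < T) (hδ : 0 < δ)
    (hT : ∀ s ≤ s₁, ∀ θ ∈ Metric.sphere (0 : EuclideanSpace ℝ (Fin n)) 1,
      cyl (((n : ℝ) - 2) / 2) u x (2 * s - T) θ + δ ≤ cyl (((n : ℝ) - 2) / 2) u x T θ) :
    ReflectionLE u x T s₁ := by
  have hn' : (3 : ℝ) ≤ n := by exact_mod_cast hn
  obtain ⟨s₀, hs₀, hP₀⟩ := h.exists_reflectionLE hn hΩ s₁
  refine IsClosed.Icc_subset_of_forall_mem_nhdsWithin (a := s₀) (b := s₁)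
    (s := {s | ReflectionLE u x T s}) ?_ hP₀ ?_ (right_mem_Icc.2 hs₀)
  · refine isClosed_of_closure_subset fun s hs => ?_
    have hs' : s ∈ Icc s₀ s₁ := closure_minimal inter_subset_right isClosed_Icc hs
    refine ⟨fun t ht θ hθ => ?_, hs'⟩
    rcases ht.2.eq_or_lt with rfl | htT
    · linarith [hT s hs'.2 θ hθ]
    rcases ht.1.eq_or_lt with rfl | hst
    · simp [two_mul]
    by_contra! hlt
    have h₁ : ContinuousAt (fun s => cyl (((n : ℝ) - 2) / 2) u x (2 * s - t) θ) s :=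
      ContinuousAt.comp (x := s) (g := fun z : ℝ × EuclideanSpace ℝ (Fin n) =>
          cyl (((n : ℝ) - 2) / 2) u x z.1 z.2) (f := fun s => (2 * s - t, θ))
        (continuousAt_cyl _ (z := (2 * s - t, θ))
          (h.contDiffAt (ray_mem hΩ (by linarith) hθ)).continuousAt) (by fun_prop)
    obtain ⟨y, ⟨hy, -⟩, hy₁, hy₂⟩ := ((mem_closure_iff_frequently.1 hs).and_eventually
      ((h₁.eventually (lt_mem_nhds hlt)).and (gt_mem_nhds hst))).exists
    exact (hy t ⟨hy₂.le, htT.le⟩ θ hθ).not_gt hy₁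
  · rintro s ⟨hP, hs⟩
    have hsT : s < T := hs.2.trans hs₁
    have hsinh : 0 < sinh (((n : ℝ) - 2) / 2 * (T - s)) :=
      sinh_pos_iff.2 (mul_pos (by linarith) (sub_pos.2 hsT))
    refine h.eventually_reflectionLE hn hΩ hsT (div_pos hδ hsinh) (fun θ hθ => ?_) hP
    rw [div_mul_cancel₀ _ hsinh.ne']
    exact hT s hs.2.le θ hθ

theorem IsYamabeSolution.cylDeriv_nonneg (h : IsYamabeSolution u Ω) (hn : 3 ≤ n)
    (hΩ : Metric.closedBall x (exp T) ⊆ Ω) (hs₁ : s₁ < T) (hδ : 0 < δ)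
    (hT : ∀ s ≤ s₁, ∀ θ ∈ Metric.sphere (0 : EuclideanSpace ℝ (Fin n)) 1,
      cyl (((n : ℝ) - 2) / 2) u x (2 * s - T) θ + δ ≤ cyl (((n : ℝ) - 2) / 2) u x T θ)
    (hθ : θ ∈ Metric.sphere (0 : EuclideanSpace ℝ (Fin n)) 1) :
    0 ≤ cylDeriv (((n : ℝ) - 2) / 2) u x s₁ θ := by
  have hn' : (3 : ℝ) ≤ n := by exact_mod_cast hn
  have hsinh : 0 < sinh (((n : ℝ) - 2) / 2 * (T - s₁)) :=
    sinh_pos_iff.2 (mul_pos (by linarith) (sub_pos.2 hs₁))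
  refine (h.cylDeriv_pos hn hΩ hs₁ (div_pos hδ hsinh) (fun θ hθ => ?_)
    (h.reflectionLE hn hΩ hs₁ hδ hT) hθ).le
  rw [div_mul_cancel₀ _ hsinh.ne']
  exact hT s₁ le_rfl θ hθ

end MovingSpheres

/-! ### The sup-inf inequality -/

section Harnack

variable {n : ℕ} {u : EuclideanSpace ℝ (Fin n) → ℝ} {Ω : Set (EuclideanSpace ℝ (Fin n))}

theorem IsYamabeSolution.nonneg_radial_deriv (h : IsYamabeSolution u Ω) (hn : 3 ≤ n)
    {x y : EuclideanSpace ℝ (Fin n)} {l ρ m B : ℝ} (hl : 0 < l) (hlρ : l < ρ)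
    (hΩ : Metric.closedBall x ρ ⊆ Ω) (hB : ∀ z ∈ Metric.closedBall x l, u z ≤ B)
    (hm : ∀ z ∈ Ω, m ≤ u z) (hlt : l ^ (n - 2) * B < ρ ^ (n - 2) * m) (hy : ‖y - x‖ = l) :
    0 ≤ ((n : ℝ) - 2) / 2 * u y + fderiv ℝ u y (y - x) := by
  have hρ : 0 < ρ := hl.trans hlρ
  have hcast : ((n - 2 : ℕ) : ℝ) = (n : ℝ) - 2 := by push_cast [show 2 ≤ n by omega]; rfl
  have hn' : (3 : ℝ) ≤ n := by exact_mod_cast hn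
  have hpow : ∀ q : ℝ, 0 < q → q ^ (n - 2) = exp (((n : ℝ) - 2) / 2 * (2 * log q)) := by
    intro q hq
    rw [← Real.exp_log (pow_pos hq (n - 2)), Real.log_pow, hcast]
    congr 1
    ring
  have hB₀ : 0 < B :=
    (h.pos x (hΩ (by simp [hρ.le]))).trans_le (hB x (by simp [hl.le]))
  set a : ℝ := ((n : ℝ) - 2) / 2 with ha
  have ha₀ : 0 < a := by rw [ha]; linarith
  have hΩ' : Metric.closedBall x (exp (log ρ)) ⊆ Ω := by rwa [exp_log hρ]
  have hθ : l⁻¹ • (y - x) ∈ Metric.sphere (0 : EuclideanSpace ℝ (Fin n)) 1 := by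
    rw [mem_sphere_zero_iff_norm, norm_smul, hy, norm_inv, Real.norm_eq_abs, abs_of_pos hl,
      inv_mul_cancel₀ hl.ne']
  have hδ : 0 < exp (a * log ρ) * m - exp (a * (2 * log l - log ρ)) * B := by
    rw [hpow l hl, hpow ρ hρ] at hlt
    have e₁ : exp (a * (2 * log l)) = exp (a * (2 * log l - log ρ)) * exp (a * log ρ) := by
      rw [← exp_add]; congr 1; ring
    have e₂ : exp (a * (2 * log ρ)) = exp (a * log ρ) * exp (a * log ρ) := by
      rw [← exp_add]; congr 1; ring
    rw [e₁, e₂] at hlt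
    nlinarith [exp_pos (a * log ρ)]
  have hlog : log l < log ρ := log_lt_log hl hlρ
  have key := h.cylDeriv_nonneg hn hΩ' hlog hδ (fun s hs θ hθ => ?_) hθ
  · rw [cylDeriv, exp_log hl, smul_smul, mul_inv_cancel₀ hl.ne', one_smul,
      add_sub_cancel] at key
    exact nonneg_of_mul_nonneg_right key (exp_pos _)
  · rw [← ha]
    have h₁ : m ≤ u (x + exp (log ρ) • θ) := hm _ (ray_mem hΩ' le_rfl hθ)
    have h₂ : x + exp (2 * s - log ρ) • θ ∈ Metric.closedBall x (exp (log l)) :=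
      ray_mem subset_rfl (by linarith) hθ
    rw [exp_log hl] at h₂
    have h₃ : cyl a u x (2 * s - log ρ) θ ≤ exp (a * (2 * log l - log ρ)) * B :=
      mul_le_mul (exp_le_exp.2 (by nlinarith)) (hB _ h₂)
        (h.pos _ (ray_mem hΩ' (by linarith) hθ)).le (exp_pos _).le
    have h₄ : exp (a * log ρ) * m ≤ cyl a u x (log ρ) θ :=
      mul_le_mul_of_nonneg_left h₁ (exp_pos _).le
    linarith

theorem norm_fderiv_le_of_forall_sphere {E : Type*} [NormedAddCommGroup E] [NormedSpace ℝ E]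
    {u : E → ℝ} {y : E} {l c : ℝ} (hl : 0 < l) (hc : 0 ≤ c)
    (h : ∀ x, ‖y - x‖ = l → 0 ≤ c + fderiv ℝ u y (y - x)) : ‖fderiv ℝ u y‖ ≤ c / l := by
  have key : ∀ v, fderiv ℝ u y v ≤ c / l * ‖v‖ := by
    intro v
    rcases eq_or_ne v 0 with rfl | hv
    · simp
    have hv' : 0 < ‖v‖ := norm_pos_iff.2 hv
    have := h (y + (l / ‖v‖) • v) (by
      rw [sub_add_cancel_left, norm_neg, norm_smul, Real.norm_eq_abs, abs_of_pos (by positivity),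
        div_mul_cancel₀ _ hv'.ne'])
    rw [sub_add_cancel_left, map_neg, map_smul, smul_eq_mul] at this
    have h₁ : l / ‖v‖ * fderiv ℝ u y v ≤ c := by linarith
    rw [div_mul_eq_mul_div, div_le_iff₀ hv'] at h₁
    rw [div_mul_eq_mul_div, le_div_iff₀ hl]
    linarith
  refine ContinuousLinearMap.opNorm_le_bound _ (by positivity) fun v => abs_le.2 ⟨?_, key v⟩
  have := key (-v)
  rw [map_neg, norm_neg] at this
  linarith

theorem exists_add_le_of_lap_lt (hΩ : IsOpen Ω) (hu : ContDiffOn ℝ 2 u Ω)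
    {x : EuclideanSpace ℝ (Fin n)} {l κ : ℝ} (hl : 0 ≤ l) (hx : Metric.closedBall x l ⊆ Ω)
    (hlap : ∀ y ∈ Metric.closedBall x l, lap u y + 2 * n * κ < 0) :
    ∃ y ∈ Metric.closedBall x l, u y + κ * l ^ 2 ≤ u x := by
  have hcont : ContinuousOn (fun y => u y + κ * ‖y - x‖ ^ 2) (Metric.closedBall x l) :=
    (hu.continuousOn.mono hx).add (by fun_prop)
  obtain ⟨y, hy, hmin⟩ := (isCompact_closedBall x l).exists_isMinOn ⟨x, by simp [hl]⟩ hcont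
  refine ⟨y, hy, ?_⟩
  have hyx : u y + κ * ‖y - x‖ ^ 2 ≤ u x := by
    simpa using hmin (show x ∈ Metric.closedBall x l by simp [hl])
  rw [mem_closedBall_iff_norm] at hy
  rcases hy.eq_or_lt with heq | hlt
  · rwa [heq] at hyx
  have hyΩ : y ∈ Ω := hx (mem_closedBall_iff_norm.2 hy)
  have hnear : ∀ᶠ z in 𝓝 y, z ∈ Metric.ball x l :=
    Metric.isOpen_ball.mem_nhds (mem_ball_iff_norm.2 hlt)
  have hdir : ∀ i, 0 ≤ fderiv ℝ (fderiv ℝ u) y (EuclideanSpace.basisFun (Fin n) ℝ i)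
      (EuclideanSpace.basisFun (Fin n) ℝ i) + 2 * κ := by
    intro i
    set e := EuclideanSpace.basisFun (Fin n) ℝ i with he
    have hline : ∀ τ : ℝ, HasDerivAt (fun τ : ℝ => y + τ • e) e τ := fun τ => by
      simpa using ((hasDerivAt_id τ).smul_const e).const_add y
    have hnear' : ∀ᶠ τ : ℝ in 𝓝 0, y + τ • e ∈ Metric.ball x l := by
      have : Tendsto (fun τ : ℝ => y + τ • e) (𝓝 0) (𝓝 y) := by
        simpa using (hline 0).continuousAt.tendsto
      exact this.eventually hnear
    have hnorm : ∀ τ : ℝ, ‖y + τ • e - x‖ ^ 2 = ‖y - x‖ ^ 2 + 2 * inner ℝ (y - x) e * τ + τ ^ 2 := by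
      intro τ
      rw [add_sub_right_comm, norm_add_sq_real, inner_smul_right, norm_smul, he,
        OrthonormalBasis.norm_eq_one, Real.norm_eq_abs, mul_one, sq_abs]
      ring
    have hloc : IsLocalMin (fun τ : ℝ => u (y + τ • e)
        + κ * (‖y - x‖ ^ 2 + 2 * inner ℝ (y - x) e * τ + τ ^ 2)) 0 := by
      filter_upwards [hnear'] with τ hτ
      have := hmin (Metric.ball_subset_closedBall hτ)
      simp only [Set.mem_ofPred_eq, hnorm] at this
      simpa using this
    refine hloc.nonneg_of_hasDerivAt_hasDerivAt
      (φ' := fun τ => fderiv ℝ u (y + τ • e) e + κ * (2 * inner ℝ (y - x) e + 2 * τ)) ?_ ?_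
    · filter_upwards [hnear'] with τ hτ
      have hd := (hu.contDiffAt (hΩ.mem_nhds
        (hx (Metric.ball_subset_closedBall hτ)))).differentiableAt_two
      have h₁ : HasDerivAt (fun τ : ℝ => u (y + τ • e)) (fderiv ℝ u (y + τ • e) e) τ :=
        HasFDerivAt.comp_hasDerivAt (f := fun τ : ℝ => y + τ • e) τ hd.hasFDerivAt (hline τ)
      have h₂ : HasDerivAt (fun τ : ℝ => ‖y - x‖ ^ 2 + 2 * inner ℝ (y - x) e * τ + τ ^ 2)
          (2 * inner ℝ (y - x) e + 2 * τ) τ := by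
        simpa using (((hasDerivAt_id τ).const_mul (2 * inner ℝ (y - x) e)).const_add
          (‖y - x‖ ^ 2)).fun_add (hasDerivAt_pow 2 τ)
      exact h₁.fun_add (h₂.const_mul κ)
    · have hd : HasFDerivAt (fderiv ℝ u) (fderiv ℝ (fderiv ℝ u) y) (y + (0 : ℝ) • e) := by
        simpa using (hu.contDiffAt (hΩ.mem_nhds hyΩ)).differentiableAt_fderiv.hasFDerivAt
      have h₁ : HasDerivAt (fun τ : ℝ => fderiv ℝ u (y + τ • e))
          (fderiv ℝ (fderiv ℝ u) y e) 0 :=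
        HasFDerivAt.comp_hasDerivAt (f := fun τ : ℝ => y + τ • e) 0 hd (hline 0)
      have h₂ := h₁.clm_apply (hasDerivAt_const (0 : ℝ) e)
      have h₃ : HasDerivAt (fun τ : ℝ => κ * (2 * inner ℝ (y - x) e + 2 * τ)) (2 * κ) 0 := by
        have := (((hasDerivAt_id (0 : ℝ)).const_mul 2).const_add
          (2 * inner ℝ (y - x) e)).const_mul κ
        simpa [mul_comm] using this
      exact (h₂.fun_add h₃).congr_deriv (by simp)
  have hsum := Finset.sum_nonneg fun i (_ : i ∈ Finset.univ) => hdir i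
  rw [Finset.sum_add_distrib, ← lap_eq_sum_orthonormalBasis] at hsum
  have := hlap y (mem_closedBall_iff_norm.2 hy)
  simp only [Finset.sum_const, Finset.card_univ, Fintype.card_fin, nsmul_eq_mul] at hsum
  linarith

/-- Selection of a point near which `u` is controlled by its value at the point. -/
theorem exists_doubling_point {x₀ : EuclideanSpace ℝ (Fin n)} {r : ℝ} (hr : 0 < r) (hn : 3 ≤ n)
    (hu : ContinuousOn u (Metric.closedBall x₀ r))
    (hpos : ∀ x ∈ Metric.closedBall x₀ r, 0 < u x) :
    ∃ x, ∃ σ > 0, Metric.closedBall x σ ⊆ Metric.closedBall x₀ r ∧ σ ≤ r ∧ u x₀ ≤ u x ∧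
      u x₀ ^ 2 * r ^ (n - 2) ≤ u x ^ 2 * (2 * σ) ^ (n - 2) ∧
      ∀ y ∈ Metric.closedBall x σ, u y ≤ 2 ^ (n - 2) * u x := by
  have hk : n - 2 ≠ 0 := by omega
  generalize n - 2 = k at hk
  have hx₀ : x₀ ∈ Metric.closedBall x₀ r := by simp [hr.le]
  have hcont : ContinuousOn (fun x => u x ^ 2 * (r - ‖x - x₀‖) ^ k) (Metric.closedBall x₀ r) :=
    (hu.pow 2).mul (by fun_prop)
  obtain ⟨x, hx, hmax⟩ := (isCompact_closedBall x₀ r).exists_isMaxOn ⟨x₀, hx₀⟩ hcont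
  have hle : u x₀ ^ 2 * r ^ k ≤ u x ^ 2 * (r - ‖x - x₀‖) ^ k := by simpa using hmax hx₀
  have hux := hpos x hx
  have hux₀ := hpos x₀ hx₀
  rw [mem_closedBall_iff_norm] at hx
  have hd : 0 < r - ‖x - x₀‖ := by
    refine (sub_nonneg.2 hx).lt_of_ne fun h₀ => ?_
    rw [← h₀, zero_pow hk, mul_zero] at hle
    exact hle.not_gt (by positivity)
  have hsub : ∀ y ∈ Metric.closedBall x ((r - ‖x - x₀‖) / 2),
      (r - ‖x - x₀‖) / 2 ≤ r - ‖y - x₀‖ := by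
    intro y hy
    rw [mem_closedBall_iff_norm] at hy
    have := norm_sub_le_norm_sub_add_norm_sub y x x₀
    linarith
  have hsub' : Metric.closedBall x ((r - ‖x - x₀‖) / 2) ⊆ Metric.closedBall x₀ r := fun y hy =>
    mem_closedBall_iff_norm.2 (by linarith [hsub y hy])
  refine ⟨x, (r - ‖x - x₀‖) / 2, by positivity, hsub', by linarith [norm_nonneg (x - x₀)], ?_, ?_,
    fun y hy => ?_⟩
  · have h₁ : (r - ‖x - x₀‖) ^ k ≤ r ^ k :=
      pow_le_pow_left₀ hd.le (by linarith [norm_nonneg (x - x₀)]) k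
    have h₂ : u x₀ ^ 2 * r ^ k ≤ u x ^ 2 * r ^ k :=
      hle.trans (mul_le_mul_of_nonneg_left h₁ (by positivity))
    exact le_of_sq_le_sq (le_of_mul_le_mul_right h₂ (by positivity)) hux.le
  · rwa [mul_div_cancel₀ _ two_ne_zero]
  · have h₁ : u y ^ 2 * ((r - ‖x - x₀‖) / 2) ^ k ≤ u x ^ 2 * (r - ‖x - x₀‖) ^ k :=
      (mul_le_mul_of_nonneg_left (pow_le_pow_left₀ (by positivity) (hsub y hy) k)
        (by positivity)).trans (hmax (hsub' hy))
    rw [div_pow, mul_div_assoc', div_le_iff₀ (by positivity)] at h₁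
    have h₂ : u y ^ 2 ≤ u x ^ 2 * 2 ^ k :=
      le_of_mul_le_mul_right (by linarith) (pow_pos hd k)
    have h₃ : (1 : ℝ) ≤ 2 ^ k := one_le_pow₀ one_le_two
    refine le_of_sq_le_sq (h₂.trans ?_) (by positivity)
    rw [mul_pow, mul_comm]
    exact mul_le_mul_of_nonneg_right (by nlinarith) (by positivity)

theorem IsYamabeSolution.exists_mul_le (hn : 3 ≤ n) {r : ℝ} (hr : 0 < r) :
    ∃ C : ℝ, 0 ≤ C ∧ ∀ (Ω : Set (EuclideanSpace ℝ (Fin n))) (u : EuclideanSpace ℝ (Fin n) → ℝ)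
      (x₀ : EuclideanSpace ℝ (Fin n)) (m : ℝ), IsYamabeSolution u Ω →
      Metric.closedBall x₀ (2 * r) ⊆ Ω → (∀ z ∈ Ω, m ≤ u z) → u x₀ * m ≤ C := by
  have hn' : (3 : ℝ) ≤ n := by exact_mod_cast hn
  have hcast : ((n - 2 : ℕ) : ℝ) = (n : ℝ) - 2 := by push_cast [show 2 ≤ n by omega]; rfl
  set a : ℝ := ((n : ℝ) - 2) / 2 with ha
  set p : ℝ := ((n : ℝ) + 2) / ((n : ℝ) - 2) with hp
  have ha₀ : 0 < a := by rw [ha]; linarith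
  have hp₀ : 0 < p := div_pos (by linarith) (by linarith)
  have hn₀ : (0 : ℝ) < n := by linarith
  set R : ℝ := 1 + a * 2 ^ (n - 2) * (4 * n * 2 ^ p) with hR
  have hR₀ : 1 ≤ R := by rw [hR]; linarith [show 0 ≤ a * 2 ^ (n - 2) * (4 * n * 2 ^ p) by positivity]
  have hη : a * 2 ^ (n - 2) / R < 1 / (4 * n * 2 ^ p) := by
    rw [div_lt_div_iff₀ (by linarith) (by positivity), hR]
    linarith
  have hη' : (1 : ℝ) / (4 * n * 2 ^ p) ≤ 1 / 2 := by
    have : (1 : ℝ) ≤ 2 ^ p := Real.one_le_rpow one_le_two hp₀.le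
    refine one_div_le_one_div_of_le two_pos ?_
    nlinarith
  refine ⟨(2 * (2 * R + 1) / r) ^ (n - 2), by positivity, fun Ω u x₀ m h hΩ hm => ?_⟩
  by_contra! hC
  have hrΩ : Metric.closedBall x₀ r ⊆ Ω :=
    (Metric.closedBall_subset_closedBall (by linarith)).trans hΩ
  have hx₀ : x₀ ∈ Ω := hrΩ (by simp [hr.le])
  have hux₀ := h.pos x₀ hx₀
  have hC₀ : 0 < u x₀ * m := lt_of_le_of_lt (by positivity) hC
  have hm₀ : 0 < m := pos_of_mul_pos_right hC₀ hux₀.le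
  rw [div_pow, div_lt_iff₀ (by positivity)] at hC
  obtain ⟨x, σ, hσ, hσr, hσr', hux, hbig, hdouble⟩ := exists_doubling_point hr hn
    (h.contDiffOn.continuousOn.mono hrΩ) fun x hx => h.pos x (hrΩ hx)
  have hM : 0 < u x := hux₀.trans_le hux
  set M := u x with hMdef
  set l : ℝ := M ^ (-2 / ((n : ℝ) - 2)) with hldef
  have hl : 0 < l := Real.rpow_pos_of_pos hM _
  have hn₂ : (n : ℝ) - 2 ≠ 0 := by linarith
  have hlM : l ^ (n - 2) * M ^ 2 = 1 := by
    rw [← Real.rpow_natCast l, hcast, hldef, ← Real.rpow_mul hM.le, div_mul_cancel₀ _ hn₂,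
      ← Real.rpow_natCast M, ← Real.rpow_add hM]
    norm_num
  have hlM' : M ^ p * l ^ 2 = M := by
    rw [← Real.rpow_natCast l, hldef, ← Real.rpow_mul hM.le, ← Real.rpow_add hM, hp]
    have : ((n : ℝ) + 2) / ((n : ℝ) - 2) + -2 / ((n : ℝ) - 2) * (2 : ℕ) = 1 := by
      field_simp
      push_cast
      ring
    rw [this, Real.rpow_one]
  have hlσ : (2 * R + 1) * l ≤ σ := by
    by_contra! hlt
    have h₁ : (2 * σ) ^ (n - 2) ≤ (2 * (2 * R + 1) * l) ^ (n - 2) :=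
      pow_le_pow_left₀ (by positivity) (by linarith) _
    have h₂ : M ^ 2 * (2 * σ) ^ (n - 2) ≤ (2 * (2 * R + 1)) ^ (n - 2) := by
      calc M ^ 2 * (2 * σ) ^ (n - 2) ≤ M ^ 2 * (2 * (2 * R + 1) * l) ^ (n - 2) := by gcongr
        _ = (2 * (2 * R + 1)) ^ (n - 2) * (l ^ (n - 2) * M ^ 2) := by rw [mul_pow]; ring
        _ = _ := by rw [hlM, mul_one]
    have h₃ : u x₀ * m * r ^ (n - 2) ≤ u x₀ ^ 2 * r ^ (n - 2) := by
      rw [sq]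
      gcongr
      exact hm x₀ hx₀
    linarith
  have hball : Metric.closedBall x l ⊆ Metric.closedBall x σ :=
    Metric.closedBall_subset_closedBall (by nlinarith)
  have hRl : 0 < R * l := by positivity
  have hgrad : ∀ y ∈ Metric.closedBall x l, ‖fderiv ℝ u y‖ ≤ a * (2 ^ (n - 2) * M) / (R * l) := by
    intro y hy
    have huy := h.pos y (hrΩ (hσr (hball hy)))
    have : ‖fderiv ℝ u y‖ ≤ a * u y / (R * l) := by
      refine norm_fderiv_le_of_forall_sphere hRl (by positivity) fun z hz => ?_
      have hzx : ∀ w ∈ Metric.closedBall z (R * l), w ∈ Metric.closedBall x σ := by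
        intro w hw
        rw [mem_closedBall_iff_norm] at hw hy ⊢
        have h₁ := norm_sub_le_norm_sub_add_norm_sub w z x
        have h₂ := norm_sub_le_norm_sub_add_norm_sub z y x
        rw [norm_sub_rev] at hz
        linarith
      have hzr : z ∈ Metric.closedBall x₀ r := hσr (hzx z (by simp [hRl.le]))
      refine h.nonneg_radial_deriv hn (m := m) (B := 2 ^ (n - 2) * M) (ρ := r) hRl (by nlinarith)
        ((Metric.closedBall_subset_closedBall' ?_).trans hΩ) (fun w hw => hdouble w (hzx w hw)) hm
        ?_ hz
      · linarith [Metric.mem_closedBall.1 hzr]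
      · refine lt_of_mul_lt_mul_right ?_ hM.le
        calc (R * l) ^ (n - 2) * (2 ^ (n - 2) * M) * M
            = (2 * R) ^ (n - 2) * (l ^ (n - 2) * M ^ 2) := by rw [mul_pow, mul_pow]; ring
          _ = (2 * R) ^ (n - 2) := by rw [hlM, mul_one]
          _ ≤ (2 * (2 * R + 1)) ^ (n - 2) := by gcongr; linarith
          _ < u x₀ * m * r ^ (n - 2) := hC
          _ ≤ M * m * r ^ (n - 2) := by gcongr
          _ = r ^ (n - 2) * m * M := by ring
    refine this.trans ?_
    gcongr
    exact hdouble y (hball hy)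
  have hosc : ∀ y ∈ Metric.closedBall x l, |u y - M| < M * (1 / (4 * n * 2 ^ p)) := by
    intro y hy
    have h₁ := (convex_closedBall x l).norm_image_sub_le_of_norm_fderiv_le
      (fun z hz => (h.contDiffAt (hrΩ (hσr (hball hz)))).differentiableAt_two) hgrad
      (Metric.mem_closedBall_self hl.le) hy
    rw [mem_closedBall_iff_norm] at hy
    calc |u y - M| ≤ a * (2 ^ (n - 2) * M) / (R * l) * ‖y - x‖ := h₁
      _ ≤ a * (2 ^ (n - 2) * M) / (R * l) * l := by gcongr
      _ = M * (a * 2 ^ (n - 2) / R) := by field_simp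
      _ < M * (1 / (4 * n * 2 ^ p)) := by gcongr
  have hMp : 0 < M ^ p := Real.rpow_pos_of_pos hM p
  obtain ⟨y, hy, hyx⟩ := exists_add_le_of_lap_lt (κ := M ^ p / (4 * n * 2 ^ p)) h.isOpen
    h.contDiffOn hl.le (hball.trans (hσr.trans hrΩ)) (fun y hy => by
      have h₁ : M / 2 ≤ u y := by
        have := (abs_lt.1 (hosc y hy)).1
        nlinarith
      have h₂ : (M / 2) ^ p ≤ -lap u y := by
        rw [h.neg_lap_eq y (hrΩ (hσr (hball hy)))]
        exact Real.rpow_le_rpow (by positivity) h₁ hp₀.le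
      rw [Real.div_rpow hM.le zero_le_two] at h₂
      have h₃ : 2 * n * (M ^ p / (4 * n * 2 ^ p)) = M ^ p / 2 ^ p / 2 := by
        field_simp
        norm_num
      have h₄ : 0 < M ^ p / 2 ^ p := by positivity
      linarith)
  have h₁ := (abs_lt.1 (hosc y hy)).1
  have h₂ : M ^ p / (4 * n * 2 ^ p) * l ^ 2 = M * (1 / (4 * n * 2 ^ p)) := by
    rw [div_mul_eq_mul_div, hlM']
    ring
  linarith

end Harnack

/- STATEMENT 10 (Korevaar–Mazzeo–Pacard–Schoen): for `Ω ⊂ ℝⁿ` open (`n ≥ 3`) and `K ⊂ Ω`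
compact there is `c = c(K, n, Ω)` such that every positive `C²` solution of
`-Δu = u^{(n+2)/(n-2)}` in `Ω` satisfies `(sup_K u)·(inf_Ω u) ≤ c`. -/
theorem stmt10 (n : ℕ) (hn : 3 ≤ n) (Ω K : Set (EuclideanSpace ℝ (Fin n)))
    (hΩ : IsOpen Ω) (hK : IsCompact K) (hKΩ : K ⊆ Ω) :
    ∃ c : ℝ, ∀ u : EuclideanSpace ℝ (Fin n) → ℝ,
      ContDiffOn ℝ 2 u Ω → (∀ x ∈ Ω, 0 < u x) →
      (∀ x ∈ Ω, -lap u x = u x ^ (((n : ℝ) + 2) / ((n : ℝ) - 2))) →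
      sSup (u '' K) * sInf (u '' Ω) ≤ c := by
  obtain ⟨δ, hδ, hδΩ⟩ := hK.exists_cthickening_subset_open hΩ hKΩ
  obtain ⟨C, hC, hmul⟩ := IsYamabeSolution.exists_mul_le hn (half_pos hδ)
  refine ⟨C, fun u hu hpos heq => ?_⟩
  rcases K.eq_empty_or_nonempty with rfl | hne
  · simpa using hC
  obtain ⟨x, hx, hsup⟩ := hK.exists_sSup_image_eq hne (hu.continuousOn.mono hKΩ)
  rw [hsup]
  refine hmul Ω u x _ ⟨hΩ, hu, hpos, heq⟩ ?_ fun z hz => ?_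
  · rw [mul_div_cancel₀ _ two_ne_zero]
    exact (Metric.closedBall_subset_cthickening hx δ).trans hδΩ
  · exact csInf_le ⟨0, by rintro _ ⟨z, hz, rfl⟩; exact (hpos z hz).le⟩ (mem_image_of_mem u hz)
end

section
/- (Brezis–Merle corollary) Let Ω ⊂ ℝ² be open, K ⊂ Ω compact. If u solves -Δu = V e^u in Ω with 0 < a ≤ V ≤ b, then sup_K u ≤ c where c depends only on a, b, inf_Ω u, K and Ω. -/
open MeasureTheory Real

/-- The point `(cos θ, sin θ)` of the unit circle. -/
noncomputable def unitCirclePoint (θ : ℝ) : EuclideanSpace ℝ (Fin 2) :=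
  cos θ • EuclideanSpace.single 0 1 + sin θ • EuclideanSpace.single 1 1

/-- The unit tangent `(-sin θ, cos θ)` to the unit circle. -/
noncomputable def unitCircleTangent (θ : ℝ) : EuclideanSpace ℝ (Fin 2) :=
  -sin θ • EuclideanSpace.single 0 1 + cos θ • EuclideanSpace.single 1 1

/-- The average of `v` over the circle of radius `exp t` centred at `p`. -/
noncomputable def logCircleAverage (v : EuclideanSpace ℝ (Fin 2) → ℝ)
    (p : EuclideanSpace ℝ (Fin 2)) (t : ℝ) : ℝ :=
  (2 * π)⁻¹ * ∫ θ in 0..2 * π, v (p + exp t • unitCirclePoint θ)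

lemma norm_unitCirclePoint (θ : ℝ) : ‖unitCirclePoint θ‖ = 1 := by
  simp [unitCirclePoint, EuclideanSpace.norm_eq]

lemma hasDerivAt_unitCirclePoint (θ : ℝ) :
    HasDerivAt unitCirclePoint (unitCircleTangent θ) θ :=
  ((hasDerivAt_cos θ).smul_const _).add ((hasDerivAt_sin θ).smul_const _)

lemma hasDerivAt_unitCircleTangent (θ : ℝ) :
    HasDerivAt unitCircleTangent (-unitCirclePoint θ) θ := by
  have h := ((hasDerivAt_sin θ).neg.smul_const (EuclideanSpace.single (0 : Fin 2) (1 : ℝ))).add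
    ((hasDerivAt_cos θ).smul_const (EuclideanSpace.single (1 : Fin 2) (1 : ℝ)))
  refine HasDerivAt.congr_deriv h ?_
  simp [unitCirclePoint, add_comm]

@[fun_prop]
lemma continuous_unitCirclePoint : Continuous unitCirclePoint := by
  unfold unitCirclePoint; fun_prop

@[fun_prop]
lemma continuous_unitCircleTangent : Continuous unitCircleTangent := by
  unfold unitCircleTangent; fun_prop

lemma lap_eq_fderiv_circle (v : EuclideanSpace ℝ (Fin 2) → ℝ) (x : EuclideanSpace ℝ (Fin 2))
    (θ : ℝ) :
    lap v x = fderiv ℝ (fderiv ℝ v) x (unitCirclePoint θ) (unitCirclePoint θ) +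
      fderiv ℝ (fderiv ℝ v) x (unitCircleTangent θ) (unitCircleTangent θ) := by
  simp only [lap, Fin.sum_univ_two, iteratedFDeriv_two_apply, unitCirclePoint, unitCircleTangent,
    map_add, map_smul, add_apply, smul_apply, smul_eq_mul,
    Matrix.cons_val_zero, Matrix.cons_val_one]
  linear_combination (-(fderiv ℝ (fderiv ℝ v) x (EuclideanSpace.single 0 1)
      (EuclideanSpace.single 0 1)) - (fderiv ℝ (fderiv ℝ v) x (EuclideanSpace.single 1 1)
      (EuclideanSpace.single 1 1))) * sin_sq_add_cos_sq θ

lemma hasDerivAt_intervalIntegral_of_continuous {F F' : ℝ → ℝ → ℝ} {a b : ℝ}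
    (hF : Continuous (Function.uncurry F)) (hF' : Continuous (Function.uncurry F'))
    (h : ∀ t θ, HasDerivAt (fun s => F s θ) (F' t θ) t) (t : ℝ) :
    HasDerivAt (fun s => ∫ θ in a..b, F s θ) (∫ θ in a..b, F' t θ) t := by
  obtain ⟨C, hC⟩ := ((isCompact_closedBall t 1).prod
    (isCompact_uIcc (a := a) (b := b))).exists_bound_of_continuousOn hF'.continuousOn
  have hFc : ∀ s, Continuous (F s) := fun s => by fun_prop
  have hF'c : ∀ s, Continuous (F' s) := fun s => by fun_prop
  refine (intervalIntegral.hasDerivAt_integral_of_dominated_loc_of_deriv_le (bound := fun _ => C)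
    (Metric.closedBall_mem_nhds t one_pos) (.of_forall fun s => (hFc s).aestronglyMeasurable)
    ((hFc t).intervalIntegrable _ _) (hF'c t).aestronglyMeasurable
    (.of_forall fun θ hθ s hs => hC (s, θ) ⟨hs, Set.uIoc_subset_uIcc hθ⟩)
    intervalIntegrable_const (.of_forall fun θ _ s _ => h s θ)).2

/-- The derivative of `logCircleAverage v p` in the logarithmic radius. -/
noncomputable def logCircleAverageDeriv (v : EuclideanSpace ℝ (Fin 2) → ℝ)
    (p : EuclideanSpace ℝ (Fin 2)) (t : ℝ) : ℝ :=
  (2 * π)⁻¹ * ∫ θ in 0..2 * π,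
    fderiv ℝ v (p + exp t • unitCirclePoint θ) (exp t • unitCirclePoint θ)

section CircleAverage

variable {v : EuclideanSpace ℝ (Fin 2) → ℝ}

lemma continuous_fderiv_fderiv_of_contDiff_two (hv : ContDiff ℝ 2 v) :
    Continuous (fderiv ℝ (fderiv ℝ v)) :=
  (hv.fderiv_right (m := 1) (by norm_num)).continuous_fderiv (by norm_num)

lemma continuous_lap (hv : ContDiff ℝ 2 v) : Continuous (lap v) := by
  have h := continuous_fderiv_fderiv_of_contDiff_two hv
  have e : lap v = fun x =>
      fderiv ℝ (fderiv ℝ v) x (unitCirclePoint 0) (unitCirclePoint 0) +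
        fderiv ℝ (fderiv ℝ v) x (unitCircleTangent 0) (unitCircleTangent 0) :=
    funext fun x => lap_eq_fderiv_circle v x 0
  rw [e]
  fun_prop

lemma hasDerivAt_logCircleAverage (hv : ContDiff ℝ 2 v) (p : EuclideanSpace ℝ (Fin 2)) (t : ℝ) :
    HasDerivAt (logCircleAverage v p) (logCircleAverageDeriv v p t) t := by
  have hc := hv.continuous
  have hc1 := hv.continuous_fderiv (by norm_num)
  refine (hasDerivAt_intervalIntegral_of_continuous
    (F := fun t θ => v (p + exp t • unitCirclePoint θ))
    (F' := fun t θ => fderiv ℝ v (p + exp t • unitCirclePoint θ) (exp t • unitCirclePoint θ))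
    (by unfold Function.uncurry; fun_prop) (by unfold Function.uncurry; fun_prop)
    (fun t θ => ?_) t).const_mul _
  exact ((hv.differentiable (by norm_num)) _).hasFDerivAt.comp_hasDerivAt t
    (((Real.hasDerivAt_exp t).smul_const (unitCirclePoint θ)).const_add p)

lemma hasDerivAt_logCircleAverageDeriv (hv : ContDiff ℝ 2 v) (p : EuclideanSpace ℝ (Fin 2))
    (t : ℝ) :
    HasDerivAt (logCircleAverageDeriv v p)
      ((2 * π)⁻¹ * ∫ θ in 0..2 * π, exp (2 * t) * lap v (p + exp t • unitCirclePoint θ)) t := by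
  have hc1 := hv.continuous_fderiv (by norm_num)
  have hc2 := continuous_fderiv_fderiv_of_contDiff_two hv
  have hcl := continuous_lap hv
  have hd : Differentiable ℝ (fderiv ℝ v) :=
    (hv.fderiv_right (m := 1) (by norm_num)).differentiable (by norm_num)
  let A : ℝ → ℝ → ℝ := fun t θ =>
    fderiv ℝ (fderiv ℝ v) (p + exp t • unitCirclePoint θ) (exp t • unitCirclePoint θ)
      (exp t • unitCirclePoint θ) +
    fderiv ℝ v (p + exp t • unitCirclePoint θ) (exp t • unitCirclePoint θ)
  let B : ℝ → ℝ := fun θ =>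
    fderiv ℝ (fderiv ℝ v) (p + exp t • unitCirclePoint θ) (exp t • unitCircleTangent θ)
      (exp t • unitCircleTangent θ) +
    fderiv ℝ v (p + exp t • unitCirclePoint θ) (exp t • -unitCirclePoint θ)
  have hA : HasDerivAt (logCircleAverageDeriv v p) ((2 * π)⁻¹ * ∫ θ in 0..2 * π, A t θ) t := by
    refine (hasDerivAt_intervalIntegral_of_continuous
      (F := fun t θ => fderiv ℝ v (p + exp t • unitCirclePoint θ) (exp t • unitCirclePoint θ))
      (F' := A)
      (by unfold Function.uncurry; fun_prop) (by unfold Function.uncurry; fun_prop)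
      (fun t θ => ?_) t).const_mul _
    have h := (Real.hasDerivAt_exp t).smul_const (unitCirclePoint θ)
    exact ((hd _).hasFDerivAt.comp_hasDerivAt t (h.const_add p)).clm_apply h
  have hBc : Continuous B := by fun_prop
  have hB : ∫ θ in 0..2 * π, B θ = 0 := by
    rw [intervalIntegral.integral_eq_sub_of_hasDerivAt
      (f := fun θ => fderiv ℝ v (p + exp t • unitCirclePoint θ) (exp t • unitCircleTangent θ))
      (fun θ _ => ?_) (hBc.intervalIntegrable _ _)]
    · simp [unitCirclePoint, unitCircleTangent]
    · exact ((hd _).hasFDerivAt.comp_hasDerivAt θ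
        (((hasDerivAt_unitCirclePoint θ).const_smul (exp t)).const_add p)).clm_apply
        ((hasDerivAt_unitCircleTangent θ).const_smul (exp t))
  have hAB : ∀ θ, A t θ = exp (2 * t) * lap v (p + exp t • unitCirclePoint θ) - B θ := by
    intro θ
    have he : exp (2 * t) = exp t * exp t := by rw [two_mul, exp_add]
    simp only [A, B, lap_eq_fderiv_circle v _ θ, he, map_smul, map_neg, smul_apply,
      smul_eq_mul]
    ring
  convert hA using 2
  rw [funext hAB, intervalIntegral.integral_sub (Continuous.intervalIntegrable (by fun_prop) _ _)
    (hBc.intervalIntegrable _ _), hB, sub_zero]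

lemma tendsto_logCircleAverage_atBot (hv : ContDiff ℝ 2 v) (p : EuclideanSpace ℝ (Fin 2)) :
    Filter.Tendsto (logCircleAverage v p) Filter.atBot (nhds (v p)) := by
  have hc := hv.continuous
  have h : Continuous fun r : ℝ =>
      (2 * π)⁻¹ * ∫ θ in 0..2 * π, v (p + r • unitCirclePoint θ) :=
    (intervalIntegral.continuous_parametric_intervalIntegral_of_continuous'
      (f := fun r θ => v (p + r • unitCirclePoint θ))
      (by unfold Function.uncurry; fun_prop) _ _).const_mul _
  have h0 := (h.tendsto 0).comp Real.tendsto_exp_atBot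
  have e : (2 * π)⁻¹ * ∫ θ in 0..2 * π, v (p + (0 : ℝ) • unitCirclePoint θ) = v p := by
    simp only [zero_smul, add_zero, intervalIntegral.integral_const, sub_zero, smul_eq_mul]
    field_simp
  rwa [e] at h0

lemma tendsto_logCircleAverageDeriv_atBot (hv : ContDiff ℝ 2 v)
    (p : EuclideanSpace ℝ (Fin 2)) :
    Filter.Tendsto (logCircleAverageDeriv v p) Filter.atBot (nhds 0) := by
  have hc1 := hv.continuous_fderiv (by norm_num)
  have h : Continuous fun r : ℝ => (2 * π)⁻¹ * ∫ θ in 0..2 * π,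
      fderiv ℝ v (p + r • unitCirclePoint θ) (r • unitCirclePoint θ) :=
    (intervalIntegral.continuous_parametric_intervalIntegral_of_continuous'
      (f := fun r θ => fderiv ℝ v (p + r • unitCirclePoint θ) (r • unitCirclePoint θ))
      (by unfold Function.uncurry; fun_prop) _ _).const_mul _
  have h0 := (h.tendsto 0).comp Real.tendsto_exp_atBot
  have e : (2 * π)⁻¹ * ∫ θ in 0..2 * π,
      fderiv ℝ v (p + (0 : ℝ) • unitCirclePoint θ) ((0 : ℝ) • unitCirclePoint θ) = 0 := by simp
  rwa [e] at h0

lemma logCircleAverage_mono {w : EuclideanSpace ℝ (Fin 2) → ℝ} (hv : Continuous v)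
    (hw : Continuous w) {p : EuclideanSpace ℝ (Fin 2)} {t : ℝ}
    (h : ∀ θ, v (p + exp t • unitCirclePoint θ) ≤ w (p + exp t • unitCirclePoint θ)) :
    logCircleAverage v p t ≤ logCircleAverage w p t :=
  mul_le_mul_of_nonneg_left (intervalIntegral.integral_mono_on two_pi_pos.le
    (Continuous.intervalIntegrable (by fun_prop) _ _)
    (Continuous.intervalIntegrable (by fun_prop) _ _) fun θ _ => h θ) (by positivity)

lemma logCircleAverage_const (c : ℝ) (p : EuclideanSpace ℝ (Fin 2)) (t : ℝ) :
    logCircleAverage (fun _ => c) p t = c := by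
  simp only [logCircleAverage, intervalIntegral.integral_const, sub_zero, smul_eq_mul]
  field_simp

lemma logCircleAverage_const_mul (c : ℝ) (p : EuclideanSpace ℝ (Fin 2)) (t : ℝ) :
    logCircleAverage (fun x => c * v x) p t = c * logCircleAverage v p t := by
  simp only [logCircleAverage, intervalIntegral.integral_const_mul]
  ring

lemma le_logCircleAverage (hv : Continuous v) {p : EuclideanSpace ℝ (Fin 2)} {m t : ℝ}
    (h : ∀ θ, m ≤ v (p + exp t • unitCirclePoint θ)) : m ≤ logCircleAverage v p t := by
  simpa only [logCircleAverage_const] using logCircleAverage_mono continuous_const hv h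

/-- Jensen's inequality for the exponential. -/
lemma exp_logCircleAverage_le (hv : Continuous v) (p : EuclideanSpace ℝ (Fin 2)) (t : ℝ) :
    exp (logCircleAverage v p t) ≤ logCircleAverage (fun x => exp (v x)) p t := by
  set g := logCircleAverage v p t with hg
  have hi := intervalIntegral.integral_mono_on (μ := volume) two_pi_pos.le
    (f := fun θ => exp g * (v (p + exp t • unitCirclePoint θ) + (1 - g)))
    (g := fun θ => exp (v (p + exp t • unitCirclePoint θ)))
    (Continuous.intervalIntegrable (by fun_prop) _ _)
    (Continuous.intervalIntegrable (by fun_prop) _ _) fun θ _ => by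
      have := add_one_le_exp (v (p + exp t • unitCirclePoint θ) - g)
      calc _ ≤ exp g * exp (v (p + exp t • unitCirclePoint θ) - g) := by gcongr; linarith
        _ = _ := by rw [← exp_add]; ring_nf
  rw [intervalIntegral.integral_const_mul, intervalIntegral.integral_add
    (Continuous.intervalIntegrable (by fun_prop) _ _) intervalIntegrable_const,
    intervalIntegral.integral_const, smul_eq_mul, sub_zero] at hi
  have hI : ∫ θ in 0..2 * π, v (p + exp t • unitCirclePoint θ) = 2 * π * g := by
    rw [hg, logCircleAverage]; field_simp
  rw [hI] at hi
  rw [logCircleAverage, inv_mul_eq_div, le_div_iff₀ two_pi_pos]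
  linarith

end CircleAverage

/-- A function on the line, decreasing with the rate that the circle averages of a solution of
`-Δu = V exp u` have, starts at a value controlled by any later value. -/
lemma exists_bound_of_logarithmic_ode (a b m s : ℝ) (ha : 0 < a) :
    ∃ c : ℝ, ∀ (g g₁ g₂ : ℝ → ℝ) (M : ℝ),
      (∀ t, HasDerivAt g (g₁ t) t) → (∀ t, HasDerivAt g₁ (g₂ t) t) →
      (∀ t ≤ s, g₂ t ≤ -a * exp (g t + 2 * t)) →
      (∀ t ≤ -M / 2, -(4 * b) * exp (M + 2 * t) ≤ g₂ t) →
      Filter.Tendsto g Filter.atBot (nhds M) → Filter.Tendsto g₁ Filter.atBot (nhds 0) →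
      m ≤ g s → M ≤ c := by
  set T := 4 * exp (b + 1) / a + 1 with hT
  have hT1 : 1 ≤ T := by rw [hT]; have : 0 < 4 * exp (b + 1) / a := by positivity
                         linarith
  have hT0 : 0 < T := by linarith
  have haT : 4 ≤ a * exp (-b - 1) * T := by
    have : a * exp (-b - 1) * T = 4 * (exp (b + 1) * exp (-b - 1)) + a * exp (-b - 1) := by
      rw [hT]; field_simp
    rw [this, ← exp_add]
    have : 0 < a * exp (-b - 1) := by positivity
    ring_nf at *
    simp
    linarith
  refine ⟨max (2 * T - 2 * s) (2 * T * (-m - (2 + 1 / T) * (s - T))), ?_⟩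
  intro g g₁ g₂ M hg hg₁ hup hlow hgM hg₁0 hm
  rw [le_max_iff, or_iff_not_imp_left, not_le]
  intro hTs
  set t₀ := -M / 2 with ht₀
  have hts : t₀ + T ≤ s := by rw [ht₀]; linarith
  have hE : ∀ t : ℝ, HasDerivAt (fun t => exp (M + 2 * t)) (2 * exp (M + 2 * t)) t := by
    intro t
    have := (((hasDerivAt_id t).const_mul 2).const_add M).exp
    simpa [mul_comm] using this
  have hE0 : Filter.Tendsto (fun t => exp (M + 2 * t)) Filter.atBot (nhds 0) :=
    tendsto_exp_atBot.comp (Filter.tendsto_atBot_add_const_left _ _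
      (Filter.tendsto_id.const_mul_atBot two_pos))
  have mono : ∀ (f f' : ℝ → ℝ) (S : Set ℝ), Convex ℝ S → (∀ t, HasDerivAt f (f' t) t) →
      (∀ t ∈ S, 0 ≤ f' t) → MonotoneOn f S := fun f f' S hS hf hf' =>
    monotoneOn_of_hasDerivWithinAt_nonneg hS (fun t _ => (hf t).continuousAt.continuousWithinAt)
      (fun t _ => (hf t).hasDerivWithinAt) fun t ht => hf' t (interior_subset ht)
  have limit_le : ∀ (f : ℝ → ℝ) (x l : ℝ), MonotoneOn f (Set.Iic x) →
      Filter.Tendsto f Filter.atBot (nhds l) → ∀ t ≤ x, l ≤ f t := fun f x l hf hl t ht =>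
    le_of_tendsto hl ((Filter.eventually_le_atBot t).mono fun r hr => hf (hr.trans ht) ht hr)
  have anti₁ : MonotoneOn (fun t => -g₁ t) (Set.Iic s) :=
    mono _ _ _ (convex_Iic s) (fun t => (hg₁ t).neg) fun t ht => by
      have := hup t ht
      have := mul_pos ha (exp_pos (g t + 2 * t))
      linarith
  have g₁_nonpos : ∀ t ≤ s, g₁ t ≤ 0 := fun t ht => by
    have := limit_le _ _ _ anti₁ hg₁0.neg t ht
    linarith
  have anti : MonotoneOn (fun t => -g t) (Set.Iic s) :=
    mono _ _ _ (convex_Iic s) (fun t => (hg t).neg) fun t ht => by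
      linarith [g₁_nonpos t ht]
  have g_le : ∀ t ≤ s, g t ≤ M := fun t ht => by
    have := limit_le _ _ _ anti hgM.neg t ht
    linarith
  have g₁_ge : ∀ t ≤ t₀, 0 ≤ g₁ t + 2 * b * exp (M + 2 * t) := by
    refine limit_le _ _ _ (mono _ _ _ (convex_Iic t₀)
      (fun t => (hg₁ t).add ((hE t).const_mul (2 * b))) fun t ht => ?_) ?_
    · linarith [hlow t ht]
    · simpa using hg₁0.add (hE0.const_mul (2 * b))
  have g_ge : M - b ≤ g t₀ := by
    have h : ∀ t ≤ t₀, M ≤ g t + b * exp (M + 2 * t) := by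
      refine limit_le _ _ _ (mono _ _ _ (convex_Iic t₀)
        (fun t => (hg t).add ((hE t).const_mul b)) fun t ht => ?_) ?_
      · linarith [g₁_ge t ht]
      · simpa using hgM.add (hE0.const_mul b)
    have h0 := h t₀ le_rfl
    rw [show M + 2 * t₀ = 0 by rw [ht₀]; ring, exp_zero] at h0
    linarith
  have slope : g₁ (t₀ + T) ≤ -(2 + 1 / T) := by
    by_contra! hcon
    have hδ : 1 / T ≤ 1 := by rw [div_le_one hT0]; exact hT1
    have hw : ∀ t ∈ Set.Icc t₀ (t₀ + T), -b - 1 ≤ g t + 2 * t := by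
      intro t ht
      have hmono := mono (fun t => g t + (2 + 1 / T) * t) _ _ (convex_Icc t₀ (t₀ + T))
        (fun t => (hg t).add ((hasDerivAt_id t).const_mul (2 + 1 / T))) fun r hr => by
          have := anti₁ (hr.2.trans hts) hts hr.2
          simp only at this
          linarith
      have h1 := hmono ⟨le_rfl, by linarith⟩ ht ht.1
      simp only at h1
      have h2 : 1 / T * (t - t₀) ≤ 1 := by
        rw [one_div, inv_mul_le_one₀ hT0]; linarith [ht.2]
      have h3 : 2 * t₀ = -M := by rw [ht₀]; ring
      nlinarith
    have hmono := mono (fun t => -g₁ t + -(a * exp (-b - 1)) * t) _ _ (convex_Icc t₀ (t₀ + T))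
      (fun t => (hg₁ t).neg.add ((hasDerivAt_id t).const_mul (-(a * exp (-b - 1)))))
      fun r hr => by
        have h1 := hup r (hr.2.trans hts)
        have h2 : a * exp (-b - 1) ≤ a * exp (g r + 2 * r) := by gcongr; exact hw r hr
        linarith
    have h1 := hmono ⟨le_rfl, by linarith⟩ ⟨by linarith, le_rfl⟩ (show t₀ ≤ t₀ + T by linarith)
    simp only at h1
    have h2 := g₁_nonpos t₀ (by linarith)
    linarith
  have hmono := mono (fun t => -g t + -(2 + 1 / T) * t) _ _ (convex_Icc (t₀ + T) s)
    (fun t => (hg t).neg.add ((hasDerivAt_id t).const_mul (-(2 + 1 / T)))) fun r hr => by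
      have := anti₁ hts hr.2 hr.1
      simp only at this
      linarith
  have h1 := hmono ⟨le_rfl, hts⟩ ⟨hts, le_rfl⟩ hts
  simp only at h1
  have h2 := g_le _ hts
  have h3 : m ≤ M - (2 + 1 / T) * (s - t₀ - T) := by linarith
  have h4 : M - (2 + 1 / T) * (s - t₀ - T) = -M / (2 * T) - (2 + 1 / T) * (s - T) := by
    rw [ht₀]; field_simp; ring
  have h5 : M / (2 * T) ≤ -m - (2 + 1 / T) * (s - T) := by
    rw [h4] at h3
    rw [neg_div] at h3
    linarith
  rw [div_le_iff₀ (by positivity)] at h5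
  linarith

lemma ContDiffOn.exists_contDiff_eventuallyEq {E : Type*} [NormedAddCommGroup E]
    [NormedSpace ℝ E] [HasContDiffBump E] {n : ℕ∞} {u : E → ℝ} {Ω : Set E}
    (hu : ContDiffOn ℝ n u Ω) (hΩ : IsOpen Ω) {p : E} {r r' : ℝ} (hr : 0 < r) (hrr' : r < r')
    (hp : Metric.closedBall p r' ⊆ Ω) :
    ∃ v : E → ℝ, ContDiff ℝ n v ∧ ∀ x ∈ Metric.ball p r, v =ᶠ[nhds x] u := by
  let f : ContDiffBump p := ⟨r, r', hr, hrr'⟩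
  refine ⟨fun x => f x * u x, contDiff_iff_contDiffAt.2 fun x => ?_, fun x hx => ?_⟩
  · by_cases hx : x ∈ Ω
    · exact f.contDiffAt.mul (hu.contDiffAt (hΩ.mem_nhds hx))
    · have hx' : x ∉ tsupport f := fun h => hx (hp (f.tsupport_eq ▸ h))
      refine (contDiffAt_const (c := (0 : ℝ))).congr_of_eventuallyEq ?_
      filter_upwards [notMem_tsupport_iff_eventuallyEq.1 hx'] with y hy
      simp [hy]
  · filter_upwards [f.eventuallyEq_one_of_mem_ball hx] with y hy
    simp [hy]

lemma Filter.EventuallyEq.lap_eq {n : ℕ} {u v : EuclideanSpace ℝ (Fin n) → ℝ}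
    {x : EuclideanSpace ℝ (Fin n)} (h : v =ᶠ[nhds x] u) : lap v x = lap u x := by
  simp only [lap, (Filter.EventuallyEq.iteratedFDeriv ℝ h 2).eq_of_nhds]

/-- The bound at the centre of a ball, with a constant that depends only on the radius and the
bounds for the data. -/
lemma exists_bound_at_center (a b m R : ℝ) (ha : 0 < a) (hR : 0 < R) :
    ∃ c : ℝ, ∀ (Ω : Set (EuclideanSpace ℝ (Fin 2))) (u V : EuclideanSpace ℝ (Fin 2) → ℝ)
      (x₀ : EuclideanSpace ℝ (Fin 2)), IsOpen Ω → Metric.closedBall x₀ (4 * R) ⊆ Ω →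
      ContDiffOn ℝ 2 u Ω → (∀ x ∈ Ω, a ≤ V x ∧ V x ≤ b) →
      (∀ x ∈ Ω, -lap u x = V x * exp (u x)) → (∀ x ∈ Ω, m ≤ u x) → u x₀ ≤ c := by
  obtain ⟨c, hc⟩ := exists_bound_of_logarithmic_ode a b m (log R) ha
  refine ⟨max c (2 * log (2 / R)), fun Ω u V x₀ hΩ hball hu hV hlap hm => ?_⟩
  have hcont : ContinuousOn (fun x => (R - dist x x₀) * exp (u x / 2))
      (Metric.closedBall x₀ R) := by
    have := hu.continuousOn.mono ((Metric.closedBall_subset_closedBall (by linarith)).trans hball)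
    fun_prop
  obtain ⟨p, hpR, hmax⟩ := (isCompact_closedBall x₀ R).exists_isMaxOn
    ⟨x₀, Metric.mem_closedBall_self hR.le⟩ hcont
  have hmax₀ := hmax (Metric.mem_closedBall_self hR.le)
  simp only [Set.mem_ofPred_eq, dist_self, sub_zero] at hmax₀
  have hpR' : dist p x₀ < R := by
    have := (mul_pos hR (exp_pos (u x₀ / 2))).trans_le hmax₀
    linarith [pos_of_mul_pos_left this (exp_pos _).le]
  obtain ⟨σ, hσ⟩ : ∃ σ, 2 * σ = R - dist p x₀ := ⟨(R - dist p x₀) / 2, by ring⟩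
  have hσ0 : 0 < σ := by linarith
  have hσR : σ < R := by linarith [dist_nonneg (x := p) (y := x₀)]
  rw [← hσ] at hmax₀
  rcases lt_or_ge (σ * exp (u p / 2)) 1 with hsmall | hlarge
  · refine le_max_of_le_right ?_
    have h : exp (u x₀ / 2) ≤ 2 / R := by
      rw [le_div_iff₀ hR]; linarith
    have := (le_log_iff_exp_le (by positivity)).2 h
    linarith
  have hup : u x₀ ≤ u p := by
    have h : R * exp (u x₀ / 2) ≤ R * exp (u p / 2) :=
      hmax₀.trans (by gcongr; linarith [dist_nonneg (x := p) (y := x₀)])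
    have := exp_le_exp.1 (le_of_mul_le_mul_left h hR)
    linarith
  refine le_max_of_le_left (hup.trans ?_)
  have hpΩ : Metric.closedBall p (3 * R) ⊆ Ω :=
    (Metric.closedBall_subset_closedBall' (by linarith)).trans hball
  obtain ⟨v, hv, hvu⟩ := ContDiffOn.exists_contDiff_eventuallyEq (n := 2) hu hΩ
    (show 0 < 2 * R by positivity) (show 2 * R < 3 * R by linarith) hpΩ
  have hdist : ∀ t θ, dist (p + exp t • unitCirclePoint θ) p = exp t := by
    intro t θ
    simp [norm_smul, norm_unitCirclePoint]
  have hmem : ∀ t θ, exp t ≤ R → p + exp t • unitCirclePoint θ ∈ Metric.ball p (2 * R) := by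
    intro t θ ht
    rw [Metric.mem_ball, hdist]; linarith
  have hsub : Metric.ball p (2 * R) ⊆ Ω :=
    (Metric.ball_subset_closedBall.trans (Metric.closedBall_subset_closedBall (by linarith))).trans
      hpΩ
  have hvp : v p = u p := (hvu p (Metric.mem_ball_self (by positivity))).eq_of_nhds
  have hlapv := continuous_lap hv
  have hvc := hv.continuous
  refine hc _ _ _ (u p) (hasDerivAt_logCircleAverage hv p) (hasDerivAt_logCircleAverageDeriv hv p)
    (fun t ht => ?_) (fun t ht => ?_) (hvp ▸ tendsto_logCircleAverage_atBot hv p)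
    (tendsto_logCircleAverageDeriv_atBot hv p) (le_logCircleAverage hvc fun θ => ?_)
  · have htR : exp t ≤ R := (le_log_iff_exp_le hR).1 ht
    calc logCircleAverage (fun x => exp (2 * t) * lap v x) p t
        ≤ logCircleAverage (fun x => (-a * exp (2 * t)) * exp (v x)) p t := by
          refine logCircleAverage_mono (by fun_prop) (by fun_prop) fun θ => ?_
          have hx := hmem t θ htR
          set x := p + exp t • unitCirclePoint θ
          have h1 := hlap x (hsub hx)
          have h2 : a * exp (u x) ≤ V x * exp (u x) := by gcongr; exact (hV x (hsub hx)).1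
          rw [(hvu x hx).lap_eq, (hvu x hx).eq_of_nhds]
          nlinarith [exp_pos (2 * t)]
      _ = -(a * exp (2 * t) * logCircleAverage (fun x => exp (v x)) p t) := by
          rw [logCircleAverage_const_mul]; ring
      _ ≤ -(a * exp (2 * t) * exp (logCircleAverage v p t)) := by
          gcongr; exact exp_logCircleAverage_le hvc p t
      _ = -a * exp (logCircleAverage v p t + 2 * t) := by rw [exp_add]; ring
  · have htσ : exp t ≤ σ := by
      have h : exp t * exp (u p / 2) ≤ 1 := by
        rw [← exp_add, exp_le_one_iff]; linarith
      exact le_of_mul_le_mul_right (h.trans hlarge) (exp_pos _)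
    refine le_logCircleAverage (v := fun x => exp (2 * t) * lap v x) (by fun_prop) fun θ => ?_
    have hx := hmem t θ (by linarith)
    have hxp := hdist t θ
    set x := p + exp t • unitCirclePoint θ
    have hxσ : σ ≤ R - dist x x₀ := by linarith [dist_triangle x p x₀]
    have h3 := hmax (show x ∈ Metric.closedBall x₀ R by rw [Metric.mem_closedBall]; linarith)
    simp only [Set.mem_ofPred_eq] at h3
    rw [← hσ] at h3
    have h4 : σ * exp (u x / 2) ≤ σ * (2 * exp (u p / 2)) :=
      calc _ ≤ (R - dist x x₀) * exp (u x / 2) := by gcongr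
        _ ≤ _ := by linarith
    have h5 : exp (u x) ≤ 4 * exp (u p) := by
      have h := pow_le_pow_left₀ (exp_pos _).le (le_of_mul_le_mul_left h4 hσ0) 2
      rw [mul_pow, ← exp_nat_mul, ← exp_nat_mul] at h
      norm_num at h
      simpa only [mul_div_cancel₀ _ (two_ne_zero (α := ℝ))] using h
    have hb : 0 ≤ b := ha.le.trans ((hV x (hsub hx)).1.trans (hV x (hsub hx)).2)
    have h1 := hlap x (hsub hx)
    have h2 : V x * exp (u x) ≤ b * (4 * exp (u p)) :=
      mul_le_mul (hV x (hsub hx)).2 h5 (exp_pos _).le hb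
    rw [(hvu x hx).lap_eq, exp_add]
    nlinarith [exp_pos (2 * t)]
  · have hx := hmem (log R) θ (exp_log hR).le
    rw [(hvu _ hx).eq_of_nhds]
    exact hm _ (hsub hx)

/- STATEMENT 12 (Brezis–Merle corollary): for `Ω ⊂ ℝ²` open, `K ⊂ Ω` compact,
`0 < a ≤ V ≤ b` and `m ≤ inf_Ω u`, every solution of `-Δu = V e^u` in `Ω` satisfies
`sup_K u ≤ c` with `c = c(a, b, m, K, Ω)`. -/
theorem stmt12 (Ω K : Set (EuclideanSpace ℝ (Fin 2)))
    (hΩ : IsOpen Ω) (hK : IsCompact K) (hKΩ : K ⊆ Ω)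
    (a b m : ℝ) (ha : 0 < a) (hab : a ≤ b) :
    ∃ c : ℝ, ∀ (u V : EuclideanSpace ℝ (Fin 2) → ℝ),
      ContDiffOn ℝ 2 u Ω →
      (∀ x ∈ Ω, a ≤ V x ∧ V x ≤ b) →
      (∀ x ∈ Ω, -lap u x = V x * Real.exp (u x)) →
      (∀ x ∈ Ω, m ≤ u x) →
      sSup (u '' K) ≤ c := by
  obtain ⟨δ, hδ, hδΩ⟩ := hK.exists_cthickening_subset_open hΩ hKΩ
  obtain ⟨c, hc⟩ := exists_bound_at_center a b m (δ / 4) ha (by positivity)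
  refine ⟨max c 0, fun u V hu hV hlap hm => Real.sSup_le ?_ (le_max_right _ _)⟩
  rintro _ ⟨x, hx, rfl⟩
  refine le_max_of_le_left (hc Ω u V x hΩ ?_ hu hV hlap hm)
  rw [mul_div_cancel₀ δ four_ne_zero]
  exact (Metric.closedBall_subset_cthickening hx δ).trans hδΩ
end
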